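/- arXiv:2110.13498 — 3 statements merged into one kernel-verified Lean document; each statement's English description precedes it below -/
import Mathlib

section
/- Anti-concentration for the maximum of absolute values of a Gaussian vector: if (ε_1,…,ε_n) is a centered jointly Gaussian vector with nonsingular covariance matrix Σ = (σ_{ij}) satisfying c_0 ≤ σ_{ii} ≤ C_0 for all i and some constants 0 < c_0 ≤ C_0 < ∞, then for every δ > 0, sup_{x∈ℝ} | Prob( max_{i≤n} |ε_i| ≤ x + δ ) − Prob( max_{i≤n} |ε_i| ≤ x ) | ≤ C δ (1 + √(log n) + √|log δ|), where C depends only on c_0 and C_0. -/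
open MeasureTheory ProbabilityTheory

noncomputable section

namespace ZP

open Set
open scoped NNReal ENNReal

/-- Lower bound on the Gaussian tail: below `H` standard deviations, the density is at most a
multiple of the tail probability. -/
lemma gaussianPDFReal_le_mul_real_Ioi {v : ℝ≥0} (hv : v ≠ 0) {s H : ℝ} (hH : 0 ≤ H)
    (hs : s ≤ H * √v) :
    gaussianPDFReal 0 v s ≤ Real.exp 2 * (1 + H) / √v * (gaussianReal 0 v).real (Ioi s) := by
  have hv0 : (0 : ℝ) < v := by positivity
  have hσ : 0 < √(v : ℝ) := Real.sqrt_pos.2 hv0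
  have hσ2 : √(v : ℝ) ^ 2 = v := Real.sq_sqrt hv0.le
  set σ := √(v : ℝ)
  set u := σ / (1 + H) with hu
  have hu0 : 0 < u := by positivity
  have hu1 : u ≤ σ := div_le_self hσ.le (by linarith)
  have hu2 : H * u ≤ σ := by
    rw [hu, mul_div_assoc', div_le_iff₀ (by positivity)]; nlinarith
  have hpdf : ∀ t ∈ Ioc s (s + u),
      Real.exp (-2) * gaussianPDFReal 0 v s ≤ gaussianPDFReal 0 v t := by
    rintro t ⟨h1, h2⟩
    have key : t ^ 2 ≤ s ^ 2 + 4 * v := by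
      obtain ⟨w, rfl⟩ : ∃ w, t = s + w := ⟨t - s, by ring⟩
      have hw0 : 0 < w := by linarith
      have hw1 : w ≤ u := by linarith
      have e1 : s * w ≤ H * σ * w := by gcongr
      have e2 : H * σ * w ≤ σ * σ := by
        calc H * σ * w ≤ H * σ * u := by gcongr
          _ = (H * u) * σ := by ring
          _ ≤ σ * σ := by gcongr
      have e3 : w * w ≤ σ * σ := by gcongr <;> linarith
      nlinarith
    simp only [gaussianPDFReal, sub_zero]
    rw [mul_left_comm, ← Real.exp_add]
    gcongr
    rw [← sub_nonneg]
    have : -t ^ 2 / (2 * (v : ℝ)) - (-2 + -s ^ 2 / (2 * v)) = (s ^ 2 + 4 * v - t ^ 2) / (2 * v) := by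
      field_simp
      ring
    rw [this]
    exact div_nonneg (by linarith) (by positivity)
  have hmeas : u * (Real.exp (-2) * gaussianPDFReal 0 v s) ≤ (gaussianReal 0 v).real (Ioi s) := by
    calc u * (Real.exp (-2) * gaussianPDFReal 0 v s)
        = ∫ _ in Ioc s (s + u), Real.exp (-2) * gaussianPDFReal 0 v s := by
          simp [hu0.le]
      _ ≤ ∫ t in Ioc s (s + u), gaussianPDFReal 0 v t :=
          setIntegral_mono_on (integrableOn_const (by simp)) (integrable_gaussianPDFReal 0 v).integrableOn
            measurableSet_Ioc hpdf
      _ = (gaussianReal 0 v).real (Ioc s (s + u)) := by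
          rw [Measure.real, gaussianReal_apply_eq_integral 0 hv, ENNReal.toReal_ofReal]
          exact setIntegral_nonneg measurableSet_Ioc fun t _ => gaussianPDFReal_nonneg 0 v t
      _ ≤ (gaussianReal 0 v).real (Ioi s) := measureReal_mono Ioc_subset_Ioi_self
  calc gaussianPDFReal 0 v s
      = Real.exp 2 * (1 + H) / σ * (u * (Real.exp (-2) * gaussianPDFReal 0 v s)) := by
        rw [hu, Real.exp_neg]
        field_simp
    _ ≤ _ := by gcongr

/-- Beyond `H` standard deviations, the Gaussian density is at most `exp (-H ^ 2 / 2)` over the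
standard deviation. -/
lemma gaussianPDFReal_le_exp {v : ℝ≥0} (hv : v ≠ 0) {s H : ℝ} (hH : 0 ≤ H) (hs : H * √v ≤ s) :
    gaussianPDFReal 0 v s ≤ Real.exp (-H ^ 2 / 2) / √v := by
  have hv0 : (0 : ℝ) < v := by positivity
  have hs2 : H ^ 2 * v ≤ s ^ 2 := by
    have := pow_le_pow_left₀ (by positivity) hs 2
    rwa [mul_pow, Real.sq_sqrt hv0.le] at this
  rw [gaussianPDFReal, sub_zero, mul_comm, div_eq_mul_inv (Real.exp (-H ^ 2 / 2))]
  gcongr ?_ * ?_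
  · rw [Real.exp_le_exp, div_le_div_iff₀ (by positivity) (by positivity)]
    nlinarith
  · gcongr
    nlinarith [Real.pi_gt_three]

/-- A vector is maximal at index `i`, which is the first such index. -/
def IsFirstArgmax {ι : Type*} [LinearOrder ι] (i : ι) (z : ι → ℝ) : Prop :=
  ∀ j, z j ≤ z i ∧ (j < i → z j < z i)

lemma exists_isFirstArgmax {ι : Type*} [Finite ι] [Nonempty ι] [LinearOrder ι] (z : ι → ℝ) :
    ∃ i, IsFirstArgmax i z := by
  classical
  have := Fintype.ofFinite ι
  let A := Finset.univ.filter fun i => ∀ j, z j ≤ z i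
  have hA : A.Nonempty := by
    obtain ⟨i, hi⟩ := Finite.exists_max z
    exact ⟨i, by simpa [A] using hi⟩
  have hmem : ∀ j, z j ≤ z (A.min' hA) := by simpa [A] using A.min'_mem hA
  refine ⟨A.min' hA, fun j => ⟨hmem j, fun hj => lt_of_not_ge fun hle => ?_⟩⟩
  refine hj.not_ge (A.min'_le j ?_)
  simpa [A] using fun k => (hmem k).trans hle

lemma measurableSet_isFirstArgmax {ι : Type*} [Finite ι] [LinearOrder ι] (i : ι) :
    MeasurableSet {z : ι → ℝ | IsFirstArgmax i z} := by
  have := Fintype.ofFinite ι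
  simp only [IsFirstArgmax, ofPred_forall, ofPred_and]
  refine MeasurableSet.iInter fun j => MeasurableSet.inter ?_ ?_
  · exact measurableSet_le (by fun_prop) (by fun_prop)
  · by_cases h : j < i
    · simpa [h] using measurableSet_lt (f := fun z : ι → ℝ => z j) (g := fun z => z i)
        (by fun_prop) (by fun_prop)
    · simp [h]

section Gaussian

variable {Ω ι : Type*} [MeasurableSpace Ω] {μ : Measure Ω} {X : ι → Ω → ℝ}

/-- The slopes of the linear regression of a family of random variables on `X i`. -/
def regressionCoeff (μ : Measure Ω) (X : ι → Ω → ℝ) (i j : ι) : ℝ :=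
  cov[X j, X i; μ] / Var[X i; μ]

/-- The family of random variables obtained from `X` by moving `X i` to the value `s`, keeping the
residuals of the linear regression on `X i`. -/
def regressionSection (μ : Measure Ω) (X : ι → Ω → ℝ) (i : ι) (s : ℝ) (ω : Ω) (j : ι) : ℝ :=
  X j ω - regressionCoeff μ X i j * X i ω + regressionCoeff μ X i j * s

/-- The Cauchy–Schwarz inequality for the covariance. -/
lemma sq_covariance_le [IsProbabilityMeasure μ] {Y Z : Ω → ℝ} (hY : MemLp Y 2 μ)
    (hZ : MemLp Z 2 μ) :
    cov[Y, Z; μ] ^ 2 ≤ Var[Y; μ] * Var[Z; μ] := by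
  have h : ∀ t : ℝ, 0 ≤ Var[Z; μ] * (t * t) + (2 * cov[Y, Z; μ]) * t + Var[Y; μ] := fun t => by
    have h1 := variance_nonneg (Y + t • Z) μ
    rw [variance_add hY (hZ.const_smul t), variance_smul, covariance_smul_right] at h1
    linarith
  have := discrim_le_zero h
  rw [discrim] at this
  linarith

lemma regressionCoeff_self (hX : AEMeasurable (X i) μ) (hi : 0 < Var[X i; μ]) :
    regressionCoeff μ X i i = 1 := by
  rw [regressionCoeff, covariance_self hX, div_self hi.ne']

lemma regressionSection_self (hX : AEMeasurable (X i) μ) (hi : 0 < Var[X i; μ]) (s : ℝ) (ω : Ω) :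
    regressionSection μ X i s ω i = s := by
  simp [regressionSection, regressionCoeff_self hX hi]

lemma regressionSection_eval (i : ι) (ω : Ω) :
    regressionSection μ X i (X i ω) ω = fun j => X j ω := by
  ext j
  simp [regressionSection]

lemma regressionSection_eq_add (i : ι) (s : ℝ) (ω : Ω) :
    regressionSection μ X i s ω =
      regressionSection μ X i 0 ω + s • regressionCoeff μ X i := by
  ext j
  simp [regressionSection, mul_comm]

lemma measurable_regressionSection (hX : ∀ i, Measurable (X i)) (i : ι) (s : ℝ) :
    Measurable (regressionSection μ X i s) := by
  unfold regressionSection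
  fun_prop

lemma indepFun_regressionSection [Finite ι] (hX : HasGaussianLaw (fun ω => (X · ω)) μ) (i : ι)
    (hi : 0 < Var[X i; μ]) :
    IndepFun (X i) (regressionSection μ X i 0) μ := by
  have := hX.isProbabilityMeasure
  have := Fintype.ofFinite ι
  let L : (ι → ℝ) →L[ℝ] (Unit → ℝ) × (ι → ℝ) :=
    (ContinuousLinearMap.pi fun _ => .proj i).prod
      (ContinuousLinearMap.pi fun j => .proj j - regressionCoeff μ X i j • .proj i)
  have hL : HasGaussianLaw (fun ω => ((fun _ : Unit => X i ω),
      fun j => X j ω - regressionCoeff μ X i j * X i ω)) μ := hX.map_fun L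
  have h2 : ∀ j, MemLp (X j) 2 μ := fun j => (hX.eval j).memLp_two
  have hind := hL.indepFun_of_covariance_eval (X := fun _ : Unit => X i)
    (Y := fun j ω => X j ω - regressionCoeff μ X i j * X i ω) fun _ j => by
      rw [covariance_fun_sub_right (h2 i) (h2 j) ((h2 i).const_mul _),
        covariance_const_mul_right, covariance_self (h2 i).aemeasurable, regressionCoeff,
        div_mul_cancel₀ _ hi.ne', covariance_comm, sub_self]
  have := hind.comp (measurable_pi_apply ()) measurable_id
  convert! this using 1
  ext ω j
  simp [regressionSection]

/-- The probability that the section of `X` at level `s` in direction `i` has its first maximum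
at `i`: the conditional probability, given `X i = s`, that `X i` is the first maximum. -/
def firstArgmaxProb [LinearOrder ι] (μ : Measure Ω) (X : ι → Ω → ℝ) (i : ι) (s : ℝ) : ℝ≥0∞ :=
  μ {ω | IsFirstArgmax i (regressionSection μ X i s ω)}

lemma measure_inter_isFirstArgmax_regressionSection [Finite ι] [LinearOrder ι]
    (hX : HasGaussianLaw (fun ω => (X · ω)) μ) (i : ι) (hi : 0 < Var[X i; μ]) (s : ℝ)
    {B : Set ℝ} (hB : MeasurableSet B) :
    μ (X i ⁻¹' B ∩ {ω | IsFirstArgmax i (regressionSection μ X i s ω)}) =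
      μ (X i ⁻¹' B) * firstArgmaxProb μ X i s := by
  have h : {ω | IsFirstArgmax i (regressionSection μ X i s ω)} = regressionSection μ X i 0 ⁻¹'
      ((fun z => z + s • regressionCoeff μ X i) ⁻¹' {z | IsFirstArgmax i z}) := by
    ext ω
    simp [regressionSection_eq_add i s]
  rw [firstArgmaxProb, h]
  refine (indepFun_regressionSection hX i hi).measure_inter_preimage_eq_mul _ _ hB ?_
  exact (measurable_add_const _) (measurableSet_isFirstArgmax i)

/-- The outward half-cylinders over the faces of the orthant `{z | ∀ i, z i ≤ s}` are disjoint. -/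
lemma disjoint_inter_isFirstArgmax_regressionSection [LinearOrder ι] [IsProbabilityMeasure μ]
    (h2 : ∀ i, MemLp (X i) 2 μ) (hv : ∀ i, 0 < Var[X i; μ]) (s : ℝ) {i k : ι} (hik : i < k) :
    Disjoint (X i ⁻¹' Ioi s ∩ {ω | IsFirstArgmax i (regressionSection μ X i s ω)})
      (X k ⁻¹' Ioi s ∩ {ω | IsFirstArgmax k (regressionSection μ X k s ω)}) := by
  rw [Set.disjoint_left]
  rintro ω ⟨hi, hi'⟩ ⟨hk, hk'⟩
  simp only [mem_preimage, mem_Ioi] at hi hk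
  have e1 := (hi' k).1
  have e2 := (hk' i).2 hik
  rw [regressionSection_self (h2 _).aemeasurable (hv _)] at e1 e2
  simp only [regressionSection, regressionCoeff, covariance_comm (X k) (X i)] at e1 e2
  have hc := sq_covariance_le (h2 i) (h2 k)
  have hvi := hv i
  have hvk := hv k
  set c := cov[X i, X k; μ]
  set vi := Var[X i; μ]
  set vk := Var[X k; μ]
  obtain ⟨a, ha⟩ : ∃ a, X i ω = s + vi * a := ⟨(X i ω - s) / vi, by field_simp; ring⟩
  obtain ⟨b, hb⟩ : ∃ b, X k ω = s + vk * b := ⟨(X k ω - s) / vk, by field_simp; ring⟩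
  have ha0 : 0 < a := by
    rw [ha] at hi
    exact pos_of_mul_pos_right (by linarith) hvi.le
  have hb0 : 0 < b := by
    rw [hb] at hk
    exact pos_of_mul_pos_right (by linarith) hvk.le
  have f1 : vk * b ≤ c * a := by
    have : s + vk * b - c / vi * (s + vi * a) + c / vi * s = s + vk * b - c * a := by
      field_simp; ring
    rw [ha, hb, this] at e1
    linarith
  have f2 : vi * a < c * b := by
    have : s + vi * a - c / vk * (s + vk * b) + c / vk * s = s + vi * a - c * b := by
      field_simp; ring
    rw [ha, hb, this] at e2
    linarith
  have f3 : (vi * a) * (vk * b) < (c * b) * (c * a) := by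
    calc (vi * a) * (vk * b) < (c * b) * (vk * b) := by gcongr
      _ ≤ (c * b) * (c * a) := by
        gcongr
        exact (by positivity : 0 ≤ vi * a).trans f2.le
  nlinarith [mul_pos ha0 hb0]

lemma sum_measure_mul_firstArgmaxProb_le_one [Fintype ι] [LinearOrder ι]
    (hX : HasGaussianLaw (fun ω => (X · ω)) μ) (hm : ∀ i, Measurable (X i))
    (hv : ∀ i, 0 < Var[X i; μ]) (s : ℝ) :
    ∑ i, μ (X i ⁻¹' Ioi s) * firstArgmaxProb μ X i s ≤ 1 := by
  have := hX.isProbabilityMeasure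
  have h2 : ∀ j, MemLp (X j) 2 μ := fun j => (hX.eval j).memLp_two
  simp_rw [← measure_inter_isFirstArgmax_regressionSection hX _ (hv _) s measurableSet_Ioi]
  rw [← tsum_fintype (L := .unconditional _), ← measure_iUnion]
  · exact prob_le_one
  · intro i k hik
    rcases lt_or_gt_of_ne hik with h | h
    · exact disjoint_inter_isFirstArgmax_regressionSection h2 hv s h
    · exact (disjoint_inter_isFirstArgmax_regressionSection h2 hv s h).symm
  · exact fun i => (hm i measurableSet_Ioi).inter
      (measurable_regressionSection hm i s (measurableSet_isFirstArgmax i))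

/-- Disintegration along the value of `X i`. -/
lemma measure_inter_isFirstArgmax [Finite ι] [LinearOrder ι]
    (hX : HasGaussianLaw (fun ω => (X · ω)) μ) (hm : ∀ i, Measurable (X i)) (i : ι)
    (hi : 0 < Var[X i; μ]) {B : Set ℝ} (hB : MeasurableSet B) :
    μ (X i ⁻¹' B ∩ {ω | IsFirstArgmax i (X · ω)}) =
      ∫⁻ s in B, firstArgmaxProb μ X i s ∂(μ.map (X i)) := by
  have := hX.isProbabilityMeasure
  have hW := measurable_regressionSection (μ := μ) hm i 0
  let T : Set (ℝ × (ι → ℝ)) :=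
    {p | p.1 ∈ B} ∩ (fun p => p.2 + p.1 • regressionCoeff μ X i) ⁻¹' {z | IsFirstArgmax i z}
  have hT : MeasurableSet T :=
    (measurable_fst hB).inter ((by fun_prop : Measurable fun p : ℝ × (ι → ℝ) =>
      p.2 + p.1 • regressionCoeff μ X i) (measurableSet_isFirstArgmax i))
  have hpre : X i ⁻¹' B ∩ {ω | IsFirstArgmax i (X · ω)} =
      (fun ω => (X i ω, regressionSection μ X i 0 ω)) ⁻¹' T := by
    ext ω
    simp [T, ← regressionSection_eq_add, regressionSection_eval]
  have hmap := (indepFun_regressionSection hX i hi).map_prod_eq_prod_map_map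
    (hm i).aemeasurable hW.aemeasurable
  have : IsProbabilityMeasure (μ.map (regressionSection μ X i 0)) :=
    Measure.isProbabilityMeasure_map hW.aemeasurable
  rw [hpre, ← Measure.map_apply ((hm i).prodMk hW) hT, hmap, Measure.prod_apply hT,
    ← lintegral_indicator hB]
  refine lintegral_congr fun s => ?_
  rw [Measure.map_apply hW (measurable_prodMk_left hT)]
  by_cases hs : s ∈ B
  · simp [T, hs, firstArgmaxProb, regressionSection_eq_add i s, preimage]
  · simp [T, hs, preimage]

lemma measurable_firstArgmaxProb [Finite ι] [LinearOrder ι] [IsProbabilityMeasure μ]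
    (hm : ∀ i, Measurable (X i)) (i : ι) :
    Measurable (firstArgmaxProb μ X i) := by
  have hT : MeasurableSet {p : ℝ × Ω | IsFirstArgmax i (regressionSection μ X i p.1 p.2)} := by
    refine (by unfold regressionSection; fun_prop : Measurable fun p : ℝ × Ω =>
      regressionSection μ X i p.1 p.2) (measurableSet_isFirstArgmax i)
  exact measurable_measure_prodMk_left hT

lemma gaussianPDF_le_mul_measure_preimage_Ioi_add (hX : HasGaussianLaw (X i) μ)
    (hm : Measurable (X i)) (h0 : μ[X i] = 0) {c H : ℝ} (hc : 0 < c) (hcv : c ≤ Var[X i; μ])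
    (hH : 0 ≤ H) (s : ℝ) :
    gaussianPDF 0 Var[X i; μ].toNNReal s ≤
      ENNReal.ofReal (Real.exp 2 * (1 + H) / √c) * μ (X i ⁻¹' Ioi s) +
        ENNReal.ofReal (Real.exp (-H ^ 2 / 2) / √c) := by
  have := hX.isProbabilityMeasure
  have hlaw : μ.map (X i) = gaussianReal 0 Var[X i; μ].toNNReal := by
    rw [hX.map_eq_gaussianReal, h0]
  have hcoe : (Var[X i; μ].toNNReal : ℝ) = Var[X i; μ] := Real.coe_toNNReal _ (by linarith)
  have hv : Var[X i; μ].toNNReal ≠ 0 := by simpa using hc.trans_le hcv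
  have hσ : √c ≤ √(Var[X i; μ].toNNReal : ℝ) := Real.sqrt_le_sqrt (by rwa [hcoe])
  have hc' : 0 < √c := Real.sqrt_pos.2 hc
  rw [gaussianPDF]
  rcases le_total s (H * √(Var[X i; μ].toNNReal : ℝ)) with hs | hs
  · refine le_add_right ?_
    rw [← Measure.map_apply hm measurableSet_Ioi, hlaw, ← ofReal_measureReal,
      ← ENNReal.ofReal_mul (by positivity)]
    refine ENNReal.ofReal_le_ofReal ((gaussianPDFReal_le_mul_real_Ioi hv hH hs).trans ?_)
    gcongr
  · refine le_add_left (ENNReal.ofReal_le_ofReal ((gaussianPDFReal_le_exp hv hH hs).trans ?_))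
    gcongr

/-- **Anti-concentration for the maximum of a centered Gaussian vector** whose variances are
bounded below. -/
theorem measure_diff_le_of_hasGaussianLaw [Fintype ι] [LinearOrder ι]
    (hX : HasGaussianLaw (fun ω => (X · ω)) μ) (hm : ∀ i, Measurable (X i))
    (h0 : ∀ i, μ[X i] = 0) {c H : ℝ} (hc : 0 < c) (hcv : ∀ i, c ≤ Var[X i; μ])
    (hH : 0 ≤ H) (x δ : ℝ) :
    μ ({ω | ∀ i, X i ω ≤ x + δ} \ {ω | ∀ i, X i ω ≤ x}) ≤
      ENNReal.ofReal ((Real.exp 2 * (1 + H) + Fintype.card ι * Real.exp (-H ^ 2 / 2)) / √c) *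
        ENNReal.ofReal δ := by
  have := hX.isProbabilityMeasure
  have hv : ∀ i, 0 < Var[X i; μ] := fun i => hc.trans_le (hcv i)
  have hF := measurable_firstArgmaxProb (μ := μ) hm
  have hsub : {ω | ∀ i, X i ω ≤ x + δ} \ {ω | ∀ i, X i ω ≤ x} ⊆
      ⋃ i, X i ⁻¹' Ioc x (x + δ) ∩ {ω | IsFirstArgmax i (X · ω)} := by
    rintro ω ⟨h1, h2⟩
    simp only [mem_ofPred_eq, not_forall, not_le] at h1 h2
    obtain ⟨k, hk⟩ := h2
    have : Nonempty ι := ⟨k⟩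
    obtain ⟨i, hi⟩ := exists_isFirstArgmax (X · ω)
    exact mem_iUnion.2 ⟨i, ⟨hk.trans_le (hi k).1, h1 i⟩, hi⟩
  have hpoint : ∀ s, ∑ i, gaussianPDF 0 Var[X i; μ].toNNReal s * firstArgmaxProb μ X i s ≤
      ENNReal.ofReal ((Real.exp 2 * (1 + H) + Fintype.card ι * Real.exp (-H ^ 2 / 2)) / √c) := by
    intro s
    set A := ENNReal.ofReal (Real.exp 2 * (1 + H) / √c) with hA
    set B := ENNReal.ofReal (Real.exp (-H ^ 2 / 2) / √c) with hB
    calc ∑ i, gaussianPDF 0 Var[X i; μ].toNNReal s * firstArgmaxProb μ X i s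
        ≤ ∑ i, (A * (μ (X i ⁻¹' Ioi s) * firstArgmaxProb μ X i s) + B) := by
          refine Finset.sum_le_sum fun i _ => ?_
          calc _ ≤ (A * μ (X i ⁻¹' Ioi s) + B) * firstArgmaxProb μ X i s := by
                gcongr
                exact gaussianPDF_le_mul_measure_preimage_Ioi_add (hX.eval i) (hm i) (h0 i) hc
                  (hcv i) hH s
            _ = A * (μ (X i ⁻¹' Ioi s) * firstArgmaxProb μ X i s) +
                B * firstArgmaxProb μ X i s := by rw [add_mul, mul_assoc]
            _ ≤ _ := by
                gcongr
                exact mul_le_of_le_one_right' prob_le_one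
      _ = A * ∑ i, μ (X i ⁻¹' Ioi s) * firstArgmaxProb μ X i s + Fintype.card ι * B := by
          rw [Finset.sum_add_distrib, Finset.mul_sum]
          simp
      _ ≤ A * 1 + Fintype.card ι * B := by
          gcongr
          exact sum_measure_mul_firstArgmaxProb_le_one hX hm hv s
      _ = _ := by
          rw [mul_one, hA, hB, ← ENNReal.ofReal_natCast, ← ENNReal.ofReal_mul (by positivity),
            ← ENNReal.ofReal_add (by positivity) (by positivity), add_div,
            mul_div_assoc (Fintype.card ι : ℝ)]
  calc μ ({ω | ∀ i, X i ω ≤ x + δ} \ {ω | ∀ i, X i ω ≤ x})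
      ≤ ∑ i, μ (X i ⁻¹' Ioc x (x + δ) ∩ {ω | IsFirstArgmax i (X · ω)}) :=
        (measure_mono hsub).trans (measure_iUnion_fintype_le _ _)
    _ = ∑ i, ∫⁻ s in Ioc x (x + δ),
          gaussianPDF 0 Var[X i; μ].toNNReal s * firstArgmaxProb μ X i s := by
        refine Finset.sum_congr rfl fun i _ => ?_
        rw [measure_inter_isFirstArgmax hX hm i (hv i) measurableSet_Ioc,
          (hX.eval i).map_eq_gaussianReal, h0 i,
          gaussianReal_of_var_ne_zero _ (by simpa using hv i),
          setLIntegral_withDensity_eq_setLIntegral_mul _ (measurable_gaussianPDF _ _) (hF i)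
            measurableSet_Ioc]
        rfl
    _ = ∫⁻ s in Ioc x (x + δ),
          ∑ i, gaussianPDF 0 Var[X i; μ].toNNReal s * firstArgmaxProb μ X i s :=
        (lintegral_finsetSum _ fun i _ => (measurable_gaussianPDF _ _).mul (hF i)).symm
    _ ≤ ∫⁻ _ in Ioc x (x + δ),
          ENNReal.ofReal ((Real.exp 2 * (1 + H) + Fintype.card ι * Real.exp (-H ^ 2 / 2)) / √c) :=
        lintegral_mono hpoint
    _ = _ := by simp

end Gaussian

lemma hasGaussianLaw_pi_of_map_sum {Ω ι : Type*} [MeasurableSpace Ω] [Fintype ι]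
    {μ : Measure Ω} {ξ : ι → Ω → ℝ} (hm : ∀ i, Measurable (ξ i))
    (h : ∀ a : ι → ℝ, ∃ m v, μ.map (fun ω => ∑ i, a i * ξ i ω) = gaussianReal m v) :
    HasGaussianLaw (fun ω => (ξ · ω)) μ where
  isGaussian_map := by
    classical
    refine isGaussian_of_map_eq_gaussianReal fun L => ?_
    obtain ⟨m, v, hmv⟩ := h fun i => L (Pi.single i 1)
    refine ⟨m, v, ?_⟩
    rw [Measure.map_map L.measurable (by fun_prop), ← hmv]
    congr 1
    ext ω
    rw [Function.comp_apply, ← ContinuousLinearMap.coe_coe, LinearMap.pi_apply_eq_sum_univ]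
    refine Finset.sum_congr rfl fun i _ => ?_
    rw [smul_eq_mul, mul_comm]
    congr 2
    ext j
    simp [Pi.single_apply, eq_comm]

/-- A family together with its opposite. -/
def signed {Ω ι : Type*} (ξ : ι → Ω → ℝ) : ι ⊕ ι → Ω → ℝ :=
  Sum.elim ξ fun i ω => -ξ i ω

lemma hasGaussianLaw_signed {Ω ι : Type*} [MeasurableSpace Ω] [Finite ι] {μ : Measure Ω}
    {ξ : ι → Ω → ℝ} (h : HasGaussianLaw (fun ω => (ξ · ω)) μ) :
    HasGaussianLaw (fun ω => (signed ξ · ω)) μ := by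
  have := Fintype.ofFinite ι
  let L : (ι → ℝ) →L[ℝ] (ι ⊕ ι → ℝ) :=
    ContinuousLinearMap.pi (Sum.elim (fun i => .proj i) fun i => -.proj i)
  convert! h.map_fun L using 1
  ext ω (i | i) <;> simp [L, signed]

/-- **Anti-concentration for the maximum of absolute values of a Gaussian vector**
(Lemma 2, part 1, of Zhang–Politis): if `(ε_1,…,ε_n)` is centered jointly Gaussian with
nonsingular covariance `Σ` whose diagonal satisfies `c₀ ≤ σ_{ii} ≤ C₀`, then for every `δ > 0`,
`sup_x |P(max_i |ε_i| ≤ x + δ) − P(max_i |ε_i| ≤ x)| ≤ C δ (1 + √(log n) + √|log δ|)`,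
where `C` depends only on `c₀` and `C₀`. -/
theorem gaussian_anticoncentration (c0 C0 : ℝ) (h_c0 : 0 < c0) (h_C0 : c0 ≤ C0) :
    ∃ C : ℝ, 0 < C ∧
      ∀ (n : ℕ) (Ω : Type) (_ : MeasureSpace Ω),
        IsProbabilityMeasure (volume : Measure Ω) →
        ∀ (ξ : Fin n → Ω → ℝ) (S : Matrix (Fin n) (Fin n) ℝ),
        (∀ i, Measurable (ξ i)) →
        -- centered jointly Gaussian with covariance S
        (∀ a : Fin n → ℝ,
          Measure.map (fun ω => ∑ i, a i * ξ i ω) volume =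
            gaussianReal 0 (Real.toNNReal (∑ i, ∑ j, a i * a j * S i j))) →
        -- nonsingular covariance, with diagonal bounds
        S.det ≠ 0 →
        (∀ i, c0 ≤ S i i ∧ S i i ≤ C0) →
        ∀ δ : ℝ, 0 < δ → ∀ x : ℝ,
          |(volume {ω : Ω | ∀ i, |ξ i ω| ≤ x + δ}).toReal
              - (volume {ω : Ω | ∀ i, |ξ i ω| ≤ x}).toReal| ≤
            C * δ * (1 + Real.sqrt (Real.log n) + Real.sqrt |Real.log δ|) := by
  refine ⟨2 * (Real.exp 2 + 1) / √c0, by positivity, ?_⟩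
  intro n Ω _ _ ξ S hm hlaw _ hS δ hδ x
  have hmap : ∀ i, (volume : Measure Ω).map (ξ i) = gaussianReal 0 (S i i).toNNReal := fun i => by
    simpa [Pi.single_apply] using hlaw (Pi.single i 1)
  have hint : ∀ i, ∫ ω, ξ i ω = 0 := fun i => by
    have := integral_id_gaussianReal (μ := 0) (v := (S i i).toNNReal)
    rwa [← hmap i, integral_map (hm i).aemeasurable (by fun_prop)] at this
  have hvar : ∀ i, Var[ξ i] = S i i := fun i => by
    have := variance_id_gaussianReal (μ := 0) (v := (S i i).toNNReal)
    rwa [← hmap i, variance_map (by fun_prop) (hm i).aemeasurable, Function.id_comp,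
      Real.coe_toNNReal _ (h_c0.le.trans (hS i).1)] at this
  have hX := hasGaussianLaw_signed (hasGaussianLaw_pi_of_map_sum hm fun a => ⟨_, _, hlaw a⟩)
  have hset : ∀ y, {ω | ∀ i, |ξ i ω| ≤ y} = {ω | ∀ i, signed ξ i ω ≤ y} := fun y => by
    ext ω
    simp [signed, abs_le', forall_and]
  set H := √2 * √(Real.log n) with hH
  have hexp : n * Real.exp (-H ^ 2 / 2) ≤ 1 := by
    rcases Nat.eq_zero_or_pos n with rfl | hn
    · simp
    · have : -H ^ 2 / 2 = -Real.log n := by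
        rw [hH, mul_pow, Real.sq_sqrt (by simp), Real.sq_sqrt (Real.log_natCast_nonneg n)]
        ring
      rw [this, Real.exp_neg, Real.exp_log (by positivity), mul_inv_cancel₀ (by positivity)]
  let e : LinearOrder (Fin n ⊕ Fin n) :=
    LinearOrder.lift' (Fintype.equivFin _) (Fintype.equivFin _).injective
  have main := measure_diff_le_of_hasGaussianLaw hX
    (by rintro (i | i); exacts [hm i, (hm i).neg])
    (by rintro (i | i) <;> simp [signed, integral_neg, hint])
    h_c0 (by rintro (i | i) <;> simp [signed, variance_fun_neg, hvar, (hS i).1])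
    (by positivity : 0 ≤ H) x δ
  have hsub : {ω | ∀ i, signed ξ i ω ≤ x} ⊆ {ω | ∀ i, signed ξ i ω ≤ x + δ} :=
    fun ω h i => (h i).trans (by linarith)
  have hmeas : MeasurableSet {ω | ∀ i, signed ξ i ω ≤ x} := by
    simp only [Set.ofPred_forall]
    refine MeasurableSet.iInter ?_
    rintro (i | i)
    exacts [measurableSet_le (hm i) measurable_const,
      measurableSet_le (hm i).neg measurable_const]
  rw [hset, hset, ← measureReal_def, ← measureReal_def, ← measureReal_sdiff hsub hmeas,
    abs_of_nonneg measureReal_nonneg]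
  rw [← ENNReal.ofReal_mul (by positivity)] at main
  have hreal := ENNReal.toReal_le_of_le_ofReal (by positivity) main
  refine hreal.trans ?_
  have hs2 : √2 ≤ 2 := by rw [Real.sqrt_le_left (by norm_num)]; norm_num
  have hHle : H ≤ 2 * √(Real.log n) := by rw [hH]; gcongr
  have hK : Real.exp 2 * (1 + H) + Fintype.card (Fin n ⊕ Fin n) * Real.exp (-H ^ 2 / 2) ≤
      2 * (Real.exp 2 + 1) * (1 + √(Real.log n) + √|Real.log δ|) := by
    have h1 := Real.exp_pos 2
    have h2 := Real.sqrt_nonneg (Real.log n)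
    have h3 := Real.sqrt_nonneg |Real.log δ|
    simp only [Fintype.card_sum, Fintype.card_fin, Nat.cast_add]
    have := mul_le_mul_of_nonneg_left hHle h1.le
    nlinarith [mul_nonneg h1.le h3]
  calc _ ≤ 2 * (Real.exp 2 + 1) * (1 + √(Real.log n) + √|Real.log δ|) / √c0 * δ := by gcongr
    _ = _ := by ring

end ZP
end
end

section
/- Gaussian comparison inequality for maxima of absolute values: let (ε_1,…,ε_n) be a centered Gaussian vector with nonsingular covariance Σ = (σ_{ij}) satisfying c_0 ≤ σ_{ii} ≤ C_0, and let (ξ_1,…,ξ_n) be a centered Gaussian vector with covariance Σ* = (σ*_{ij}) (possibly singular) such that Δ = max_{i,j} |σ_{ij} − σ*_{ij}| < 1. Then for all n ≥ 1, sup_{x∈ℝ} | Prob( max_{i≤n}|ε_i| ≤ x ) − Prob( max_{i≤n}|ξ_i| ≤ x ) | ≤ C* ( Δ^{1/3}(1 + log³ n) + Δ^{1/6} / (1 + log^{1/4} n) ), where C* depends only on c_0 and C_0. -/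
open MeasureTheory ProbabilityTheory

noncomputable section

namespace ZP

/-- The standard Gaussian measure on `κ → ℝ`. -/
abbrev stdG (κ : Type*) [Fintype κ] : Measure (κ → ℝ) := Measure.pi fun _ => gaussianReal 0 1

variable {ι κ κ' : Type*} [Fintype ι] [Fintype κ] [Fintype κ']

lemma stdG_map_sum (c : κ → ℝ) :
    (stdG κ).map (fun g => ∑ k, c k * g k) = gaussianReal 0 (∑ k, c k ^ 2).toNNReal := by
  classical
  refine Measure.ext_of_charFun (funext fun t => ?_)
  let L : StrongDual ℝ (κ → ℝ) := ∑ k, c k • ContinuousLinearMap.proj k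
  have hL : (fun g : κ → ℝ => ∑ k, c k * g k) = L := by
    ext g; simp [L]
  rw [hL, charFun_map_eq_charFunDual_smul, charFunDual_pi]
  have : ∀ k, charFunDual (gaussianReal 0 1)
      ((t • L).comp (ContinuousLinearMap.single ℝ (fun _ : κ => ℝ) k))
      = charFun (gaussianReal 0 1) (t * c k) := by
    intro k
    rw [charFunDual_apply, charFun_apply_real]
    congr 1
    ext x
    congr 1
    simp [L, Pi.single_apply]
    ring
  simp_rw [this, charFun_gaussianReal, ← Complex.exp_sum]
  have h0 : 0 ≤ ∑ k, c k ^ 2 := Finset.sum_nonneg fun k _ => sq_nonneg _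
  congr 1
  simp only [NNReal.coe_one, Real.coe_toNNReal _ h0]
  push_cast
  simp [Finset.sum_mul, Finset.sum_div]
  congr 1; ext k; ring

@[fun_prop]
lemma measurable_mulVec {ι κ : Type*} [Fintype κ] (C : Matrix ι κ ℝ) :
    Measurable fun g : κ → ℝ => C.mulVec g := by
  refine measurable_pi_lambda _ fun i => ?_
  simp only [Matrix.mulVec, dotProduct]; fun_prop

lemma stdG_map_linear (C : Matrix ι κ ℝ) (a : ι → ℝ) :
    (stdG κ).map (fun g => ∑ i, a i * C.mulVec g i) =
      gaussianReal 0 (∑ i, ∑ j, a i * a j * (C * C.transpose) i j).toNNReal := by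
  have e : (fun g => ∑ i, a i * C.mulVec g i) = fun g => ∑ k, (∑ i, a i * C i k) * g k := by
    ext g
    simp only [Matrix.mulVec, dotProduct, Finset.mul_sum, Finset.sum_mul]
    rw [Finset.sum_comm]; simp only [mul_assoc]
  rw [e, stdG_map_sum]
  congr 2
  simp only [Matrix.mul_apply, Matrix.transpose_apply, sq, Finset.mul_sum, Finset.sum_mul]
  rw [Finset.sum_comm]
  refine Finset.sum_congr rfl fun i _ => ?_
  rw [Finset.sum_comm]
  exact Finset.sum_congr rfl fun j _ => Finset.sum_congr rfl fun k _ => by ring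

/-- A random vector all of whose linear functionals are centered Gaussian with variances given by
`C * Cᵀ` has the law of `C g`, where `g` is a standard Gaussian vector. -/
lemma map_eq_of_linear {Ω : Type*} [MeasurableSpace Ω] {P : Measure Ω} [IsProbabilityMeasure P]
    (X : ι → Ω → ℝ) (hX : ∀ i, Measurable (X i)) (C : Matrix ι κ ℝ)
    (h : ∀ a : ι → ℝ, P.map (fun ω => ∑ i, a i * X i ω) =
      gaussianReal 0 (∑ i, ∑ j, a i * a j * (C * C.transpose) i j).toNNReal) :
    P.map (fun ω i => X i ω) = (stdG κ).map (fun g => C.mulVec g) := by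
  classical
  have hm := measurable_mulVec C
  have hX' : Measurable fun ω i => X i ω := measurable_pi_lambda _ hX
  have := Measure.isProbabilityMeasure_map (μ := P) hX'.aemeasurable
  have := Measure.isProbabilityMeasure_map (μ := stdG κ) hm.aemeasurable
  refine Measure.ext_of_charFunDual (funext fun L => ?_)
  set a : ι → ℝ := fun i => L (Pi.single i 1) with ha
  have hL : ∀ x, L x = ∑ i, a i * x i := by
    intro x
    conv_lhs => rw [pi_eq_sum_univ' x]
    rw [map_sum]
    refine Finset.sum_congr rfl fun i _ => ?_
    rw [map_smul, smul_eq_mul, mul_comm, ha]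
  rw [charFunDual_eq_charFun_map_one, charFunDual_eq_charFun_map_one,
    Measure.map_map L.continuous.measurable hX', Measure.map_map L.continuous.measurable hm]
  have e1 : (L ∘ fun ω i => X i ω) = fun ω => ∑ i, a i * X i ω := by
    ext ω; simp [hL]
  have e2 : (L ∘ fun g => C.mulVec g) = fun g => ∑ i, a i * C.mulVec g i := by
    ext g; simp [hL]
  rw [e1, e2, h, stdG_map_linear]

lemma map_mulVec_eq (C : Matrix ι κ ℝ) (C' : Matrix ι κ' ℝ)
    (h : C * C.transpose = C' * C'.transpose) :
    (stdG κ).map (fun g => C.mulVec g) = (stdG κ').map (fun g => C'.mulVec g) :=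
  map_eq_of_linear (fun i g => C.mulVec g i)
    (fun i => (measurable_pi_apply i).comp (measurable_mulVec C)) C' fun a => by
      rw [stdG_map_linear, h]

/-- Stein's identity for the standard Gaussian distribution on the line. -/
lemma integral_id_mul_gaussianReal {u u' : ℝ → ℝ} {K : ℝ} (hu : ∀ x, HasDerivAt u (u' x) x)
    (hu' : Measurable u') (hK : ∀ x, |u x| ≤ K) (hK' : ∀ x, |u' x| ≤ K) :
    ∫ x, x * u x ∂gaussianReal 0 1 = ∫ x, u' x ∂gaussianReal 0 1 := by
  have hc : Continuous u := continuous_iff_continuousAt.2 fun x => (hu x).continuousAt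
  have hpdf : ∀ x, gaussianPDFReal 0 1 x = (√(2 * Real.pi))⁻¹ * Real.exp (-(1 / 2) * x ^ 2) := by
    intro x; simp [gaussianPDFReal]; ring_nf; simp
  have hd : ∀ x, HasDerivAt (fun x => -gaussianPDFReal 0 1 x) (x * gaussianPDFReal 0 1 x) x := by
    intro x
    rw [hpdf, funext fun y => congrArg Neg.neg (hpdf y)]
    have := ((((hasDerivAt_id x).pow 2).const_mul (-(1 / 2 : ℝ))).exp.const_mul
      ((√(2 * Real.pi))⁻¹)).neg
    refine HasDerivAt.congr_deriv this ?_
    simp; ring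
  have hi : Integrable (gaussianPDFReal 0 1) := integrable_gaussianPDFReal 0 1
  have hi1 : Integrable (fun x => x * gaussianPDFReal 0 1 x) := by
    simp_rw [hpdf]
    refine ((integrable_mul_exp_neg_mul_sq (b := 1 / 2) (by norm_num)).const_mul
      ((√(2 * Real.pi))⁻¹)).congr (ae_of_all _ fun x => ?_)
    ring
  have key := integral_mul_deriv_eq_deriv_mul_of_integrable (u := u) (u' := u')
    (v := fun x => -gaussianPDFReal 0 1 x) (v' := fun x => x * gaussianPDFReal 0 1 x)
    (fun x _ => hu x) (fun x _ => hd x)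
    (hi1.bdd_mul (c := K) hc.aestronglyMeasurable (ae_of_all _ hK))
    (hi.neg.bdd_mul (c := K) hu'.aestronglyMeasurable (ae_of_all _ hK'))
    (hi.neg.bdd_mul (c := K) hc.aestronglyMeasurable (ae_of_all _ hK))
  rw [integral_gaussianReal_eq_integral_smul one_ne_zero,
    integral_gaussianReal_eq_integral_smul one_ne_zero]
  simp only [smul_eq_mul]
  calc _ = ∫ x, u x * (x * gaussianPDFReal 0 1 x) := by congr 1; ext x; ring
    _ = _ := by rw [key, ← integral_neg]; congr 1; ext x; ring

lemma measurePreserving_update [DecidableEq κ] (k : κ) :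
    MeasurePreserving (fun p : (κ → ℝ) × ℝ => Function.update p.1 k p.2)
      ((stdG κ).prod (gaussianReal 0 1)) (stdG κ) := by
  have hm : Measurable fun p : (κ → ℝ) × ℝ => Function.update p.1 k p.2 := by
    refine measurable_pi_lambda _ fun i => ?_
    by_cases h : i = k
    · subst h; simpa using measurable_snd
    · simp only [Function.update_of_ne h]; fun_prop
  refine ⟨hm, (Measure.pi_eq fun s hs => ?_).symm⟩
  rw [Measure.map_apply hm (MeasurableSet.univ_pi hs)]
  have : (fun p : (κ → ℝ) × ℝ => Function.update p.1 k p.2) ⁻¹' (Set.univ.pi s) =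
      (Set.univ.pi (Function.update s k Set.univ)) ×ˢ (s k) := by
    ext p
    simp only [Set.mem_preimage, Set.mem_pi, Set.mem_univ, true_imp_iff, Set.mem_prod]
    constructor
    · intro h
      refine ⟨fun i => ?_, by simpa using h k⟩
      by_cases hi : i = k
      · subst hi; simp
      · simpa [hi] using h i
    · rintro ⟨h, hk⟩ i
      by_cases hi : i = k
      · subst hi; simpa using hk
      · simpa [hi] using h i
  rw [this, Measure.prod_prod, Measure.pi_pi, ← Finset.prod_erase_mul _ _ (Finset.mem_univ k),
    ← Finset.prod_erase_mul _ (fun i => gaussianReal 0 1 (s i)) (Finset.mem_univ k)]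
  simp only [Function.update_self, measure_univ, mul_one]
  congr 1
  refine Finset.prod_congr rfl fun i hi => ?_
  rw [Function.update_of_ne (Finset.ne_of_mem_erase hi)]

lemma integrable_eval_stdG (k : κ) : Integrable (fun g : κ → ℝ => g k) (stdG κ) :=
  integrable_eval (i := k) (μ := fun _ : κ => gaussianReal 0 1)
    ((memLp_id_gaussianReal 1).integrable (by simp))

/-- Stein's identity for one coordinate of a standard Gaussian vector. -/
lemma integral_eval_mul_stdG [DecidableEq κ] (k : κ) {H H' : (κ → ℝ) → ℝ} {K : ℝ}
    (hH : ∀ g, HasDerivAt (fun y => H (Function.update g k y)) (H' g) (g k))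
    (hHm : Measurable H) (hHm' : Measurable H')
    (hK : ∀ g, |H g| ≤ K) (hK' : ∀ g, |H' g| ≤ K) :
    ∫ g, g k * H g ∂stdG κ = ∫ g, H' g ∂stdG κ := by
  have hu := measurePreserving_update (κ := κ) k
  have hi : Integrable (fun g : κ → ℝ => g k * H g) (stdG κ) :=
    (integrable_eval_stdG k).mul_bdd (c := K) hHm.aestronglyMeasurable (ae_of_all _ hK)
  have hi' : Integrable H' (stdG κ) :=
    Integrable.of_bound hHm'.aestronglyMeasurable K (ae_of_all _ hK')
  have key : ∀ F : (κ → ℝ) → ℝ, Integrable F (stdG κ) →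
      ∫ g, F g ∂stdG κ =
        ∫ g, ∫ y, F (Function.update g k y) ∂gaussianReal 0 1 ∂stdG κ := by
    intro F hF
    have h1 : Integrable (fun p : (κ → ℝ) × ℝ => F (Function.update p.1 k p.2))
      ((stdG κ).prod (gaussianReal 0 1)) := by
      exact hu.integrable_comp_of_integrable hF
    rw [← integral_prod _ h1]
    conv_lhs => rw [← hu.map_eq]
    rw [integral_map hu.measurable.aemeasurable (by rw [hu.map_eq]; exact hF.1)]
  rw [key _ hi, key _ hi']
  congr 1
  ext g
  simp only [Function.update_self]
  refine integral_id_mul_gaussianReal (K := K) (fun x => ?_) ?_ (fun x => hK _) fun x => hK' _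
  · simpa using hH (Function.update g k x)
  · exact hHm'.comp (measurable_update g)

/-- Exponential weight of the `i`-th coordinate of `C g`, shifted by `b`. -/
def expWeight (C : Matrix ι κ ℝ) (b : ℝ) (i : ι) (g : κ → ℝ) : ℝ := Real.exp (C.mulVec g i - b)

/-- Sum of the exponential weights of the coordinates of `C g`. -/
def expSum (C : Matrix ι κ ℝ) (b : ℝ) (g : κ → ℝ) : ℝ := ∑ i, expWeight C b i g

lemma expWeight_pos {ι κ : Type*} [Fintype κ] (C : Matrix ι κ ℝ) (b : ℝ) (i : ι) (g : κ → ℝ) :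
    0 < expWeight C b i g :=
  Real.exp_pos _

lemma expWeight_le_expSum (C : Matrix ι κ ℝ) (b : ℝ) (i : ι) (g : κ → ℝ) :
    expWeight C b i g ≤ expSum C b g :=
  Finset.single_le_sum (f := fun i => expWeight C b i g)
    (fun j _ => (expWeight_pos C b j g).le) (Finset.mem_univ i)

lemma expSum_pos [Nonempty ι] (C : Matrix ι κ ℝ) (b : ℝ) (g : κ → ℝ) : 0 < expSum C b g :=
  Finset.sum_pos (fun i _ => expWeight_pos C b i g) Finset.univ_nonempty

@[fun_prop]
lemma measurable_expWeight {ι κ : Type*} [Fintype κ] (C : Matrix ι κ ℝ) (b : ℝ) (i : ι) :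
    Measurable (expWeight C b i) :=
  (((measurable_pi_apply i).comp (measurable_mulVec C)).sub_const b).exp

@[fun_prop]
lemma measurable_expSum (C : Matrix ι κ ℝ) (b : ℝ) : Measurable (expSum C b) :=
  Finset.measurable_fun_sum _ fun i _ => measurable_expWeight C b i

/-- Functions `ψ` with derivative `ψ'` on the positive half-line such that `s ψ(s)` and
`s² ψ'(s)` are bounded by `K`. -/
structure DecayBound (ψ ψ' : ℝ → ℝ) (K : ℝ) : Prop where
  hasDerivAt : ∀ s, 0 < s → HasDerivAt ψ (ψ' s) s
  measurable : Measurable ψ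
  measurable_deriv : Measurable ψ'
  bound : ∀ s, 0 < s → s * |ψ s| ≤ K
  bound_deriv : ∀ s, 0 < s → s ^ 2 * |ψ' s| ≤ K

lemma DecayBound.abs_mul_expWeight_le {ψ ψ' : ℝ → ℝ} {K : ℝ} (h : DecayBound ψ ψ' K)
    (C : Matrix ι κ ℝ) (b : ℝ) (i : ι) (g : κ → ℝ) :
    |ψ (expSum C b g)| * expWeight C b i g ≤ K := by
  have : Nonempty ι := ⟨i⟩
  refine le_trans ?_ (h.bound _ (expSum_pos C b g))
  rw [mul_comm]
  gcongr
  exact expWeight_le_expSum C b i g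

lemma DecayBound.abs_deriv_mul_expWeight_le {ψ ψ' : ℝ → ℝ} {K : ℝ} (h : DecayBound ψ ψ' K)
    (C : Matrix ι κ ℝ) (b : ℝ) (i j : ι) (g : κ → ℝ) :
    |ψ' (expSum C b g)| * (expWeight C b i g * expWeight C b j g) ≤ K := by
  have : Nonempty ι := ⟨i⟩
  refine le_trans ?_ (h.bound_deriv _ (expSum_pos C b g))
  rw [mul_comm, sq]
  gcongr
  · exact (expWeight_pos C b j g).le
  · exact (expSum_pos C b g).le
  · exact expWeight_le_expSum C b i g
  · exact expWeight_le_expSum C b j g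

lemma hasDerivAt_mulVec_update {ι κ : Type*} [Fintype κ] [DecidableEq κ] (C : Matrix ι κ ℝ)
    (g : κ → ℝ) (k : κ) (i : ι) :
    HasDerivAt (fun y => C.mulVec (Function.update g k y) i) (C i k) (g k) := by
  have : (fun y => C.mulVec (Function.update g k y) i) =
      fun y => C.mulVec g i + C i k * (y - g k) := by
    ext y
    have : Function.update g k y = g + Pi.single k (y - g k) := by
      ext l
      by_cases hl : l = k
      · subst hl; simp
      · simp [hl]
    rw [this, Matrix.mulVec_add, Matrix.mulVec_single]
    simp
  rw [this]
  exact ((((hasDerivAt_id (g k)).sub_const (g k)).const_mul (C i k)).const_add _).congr_deriv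
    (by simp)

/-- Gaussian integration by parts for the functions `ψ(s) eᵢ`. -/
lemma integral_eval_mul_decay [DecidableEq κ] {ψ ψ' : ℝ → ℝ} {K : ℝ} (h : DecayBound ψ ψ' K)
    (C : Matrix ι κ ℝ) (b : ℝ) (i : ι) (k : κ) :
    ∫ g, g k * (ψ (expSum C b g) * expWeight C b i g) ∂stdG κ =
      ∫ g, (∑ j, C j k * (ψ' (expSum C b g) * (expWeight C b i g * expWeight C b j g))) +
        C i k * (ψ (expSum C b g) * expWeight C b i g) ∂stdG κ := by
  have : Nonempty ι := ⟨i⟩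
  have hψ := h.measurable
  have hψ' := h.measurable_deriv
  have hK0 : 0 ≤ K := le_trans (by positivity) (h.bound 1 one_pos)
  have hS0 : 0 ≤ ∑ j, |C j k| := Finset.sum_nonneg fun _ _ => abs_nonneg _
  have hCi : |C i k| ≤ ∑ j, |C j k| :=
    Finset.single_le_sum (f := fun j => |C j k|) (fun _ _ => abs_nonneg _) (Finset.mem_univ i)
  refine integral_eval_mul_stdG (K := K * (1 + 2 * ∑ j, |C j k|)) k (fun g => ?_) (by fun_prop)
    (by fun_prop) (fun g => ?_) fun g => ?_
  · have hw : ∀ j, HasDerivAt (fun y => expWeight C b j (Function.update g k y))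
        (C j k * expWeight C b j g) (g k) := by
      intro j
      refine (((hasDerivAt_mulVec_update C g k j).sub_const b).exp).congr_deriv ?_
      simp [expWeight, mul_comm]
    have hs : HasDerivAt (fun y => expSum C b (Function.update g k y))
        (∑ j, C j k * expWeight C b j g) (g k) := HasDerivAt.fun_sum fun j _ => hw j
    have hc : HasDerivAt (fun y => ψ (expSum C b (Function.update g k y)))
        (ψ' (expSum C b g) * ∑ j, C j k * expWeight C b j g) (g k) :=
      HasDerivAt.comp (h₂ := ψ) (g k) (by simpa using h.hasDerivAt _ (expSum_pos C b g)) hs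
    refine (hc.mul (hw i)).congr_deriv ?_
    simp only [Function.update_eq_self, Finset.mul_sum, Finset.sum_mul]
    congr 1
    · exact Finset.sum_congr rfl fun j _ => by ring
    · ring
  · rw [abs_mul, abs_of_pos (expWeight_pos C b i g)]
    refine (h.abs_mul_expWeight_le C b i g).trans ?_
    nlinarith
  · refine (abs_add_le _ _).trans ?_
    have h1 : |∑ j, C j k * (ψ' (expSum C b g) * (expWeight C b i g * expWeight C b j g))| ≤
        (∑ j, |C j k|) * K := by
      refine (Finset.abs_sum_le_sum_abs _ _).trans ?_
      rw [Finset.sum_mul]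
      refine Finset.sum_le_sum fun j _ => ?_
      rw [abs_mul, abs_mul, abs_of_pos (mul_pos (expWeight_pos C b i g) (expWeight_pos C b j g))]
      exact mul_le_mul_of_nonneg_left (h.abs_deriv_mul_expWeight_le C b i j g) (abs_nonneg _)
    have h2 : |C i k * (ψ (expSum C b g) * expWeight C b i g)| ≤ (∑ j, |C j k|) * K := by
      rw [abs_mul, abs_mul, abs_of_pos (expWeight_pos C b i g)]
      exact mul_le_mul hCi (h.abs_mul_expWeight_le C b i g)
        (mul_nonneg (abs_nonneg _) (expWeight_pos C b i g).le) hS0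
    nlinarith

lemma DecayBound.integrable_mul_expWeight {ψ ψ' : ℝ → ℝ} {K : ℝ} (h : DecayBound ψ ψ' K)
    (C : Matrix ι κ ℝ) (b : ℝ) (i : ι) :
    Integrable (fun g => ψ (expSum C b g) * expWeight C b i g) (stdG κ) := by
  have hψ := h.measurable
  refine Integrable.of_bound (by fun_prop) K (ae_of_all _ fun g => ?_)
  rw [Real.norm_eq_abs, abs_mul, abs_of_pos (expWeight_pos C b i g)]
  exact h.abs_mul_expWeight_le C b i g

lemma DecayBound.integrable_deriv_mul_expWeight {ψ ψ' : ℝ → ℝ} {K : ℝ} (h : DecayBound ψ ψ' K)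
    (C : Matrix ι κ ℝ) (b : ℝ) (i j : ι) :
    Integrable (fun g => ψ' (expSum C b g) * (expWeight C b i g * expWeight C b j g))
      (stdG κ) := by
  have hψ := h.measurable_deriv
  refine Integrable.of_bound (by fun_prop) K (ae_of_all _ fun g => ?_)
  rw [Real.norm_eq_abs, abs_mul,
    abs_of_pos (mul_pos (expWeight_pos C b i g) (expWeight_pos C b j g))]
  exact h.abs_deriv_mul_expWeight_le C b i j g

lemma DecayBound.integrable_eval_mul {ψ ψ' : ℝ → ℝ} {K : ℝ} (h : DecayBound ψ ψ' K)
    (C : Matrix ι κ ℝ) (b : ℝ) (i : ι) (k : κ) :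
    Integrable (fun g => g k * (ψ (expSum C b g) * expWeight C b i g)) (stdG κ) := by
  refine (integrable_eval_stdG k).mul_bdd (c := K)
    (h.integrable_mul_expWeight C b i).aestronglyMeasurable (ae_of_all _ fun g => ?_)
  rw [Real.norm_eq_abs, abs_mul, abs_of_pos (expWeight_pos C b i g)]
  exact h.abs_mul_expWeight_le C b i g

/-- Gaussian integration by parts for the vector field `ψ(s) e` paired with `D g`. -/
lemma integral_mulVec_mul_decay {ψ ψ' : ℝ → ℝ} {K : ℝ} (h : DecayBound ψ ψ' K)
    (C D : Matrix ι κ ℝ) (b : ℝ) :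
    ∫ g, ψ (expSum C b g) * ∑ i, D.mulVec g i * expWeight C b i g ∂stdG κ =
      ∫ g, ψ' (expSum C b g) * (∑ i, ∑ j, (D * C.transpose) i j *
          (expWeight C b i g * expWeight C b j g)) +
        ψ (expSum C b g) * ∑ i, (D * C.transpose) i i * expWeight C b i g ∂stdG κ := by
  classical
  have e1 : ∀ g, ψ (expSum C b g) * ∑ i, D.mulVec g i * expWeight C b i g =
      ∑ i, ∑ k, D i k * (g k * (ψ (expSum C b g) * expWeight C b i g)) := by
    intro g
    simp only [Matrix.mulVec, dotProduct, Finset.mul_sum, Finset.sum_mul]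
    exact Finset.sum_congr rfl fun i _ => Finset.sum_congr rfl fun k _ => by ring
  have e2 : ∀ g, ψ' (expSum C b g) * (∑ i, ∑ j, (D * C.transpose) i j *
          (expWeight C b i g * expWeight C b j g)) +
        ψ (expSum C b g) * ∑ i, (D * C.transpose) i i * expWeight C b i g =
      ∑ i, ∑ k, D i k * ((∑ j, C j k * (ψ' (expSum C b g) *
        (expWeight C b i g * expWeight C b j g))) +
        C i k * (ψ (expSum C b g) * expWeight C b i g)) := by
    intro g
    simp only [Matrix.mul_apply, Matrix.transpose_apply, Finset.mul_sum, Finset.sum_mul, mul_add,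
      Finset.sum_add_distrib]
    congr 1
    · refine Finset.sum_congr rfl fun i _ => ?_
      rw [Finset.sum_comm]
      exact Finset.sum_congr rfl fun k _ => Finset.sum_congr rfl fun j _ => by ring
    · exact Finset.sum_congr rfl fun i _ => Finset.sum_congr rfl fun k _ => by ring
  simp_rw [e1, e2]
  have hI : ∀ i k, Integrable (fun g => (∑ j, C j k * (ψ' (expSum C b g) *
        (expWeight C b i g * expWeight C b j g))) +
        C i k * (ψ (expSum C b g) * expWeight C b i g)) (stdG κ) := fun i k =>
    (integrable_finsetSum _ fun j _ =>
      (h.integrable_deriv_mul_expWeight C b i j).const_mul _).add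
      ((h.integrable_mul_expWeight C b i).const_mul _)
  have hsum : ∀ (d : ι → κ → ℝ) (F : ι → κ → (κ → ℝ) → ℝ),
      (∀ i k, Integrable (F i k) (stdG κ)) →
      ∫ g, ∑ i, ∑ k, d i k * F i k g ∂stdG κ = ∑ i, ∑ k, d i k * ∫ g, F i k g ∂stdG κ := by
    intro d F hF
    rw [integral_finsetSum _ fun i _ => integrable_finsetSum _ fun k _ => (hF i k).const_mul _]
    refine Finset.sum_congr rfl fun i _ => ?_
    rw [integral_finsetSum _ fun k _ => (hF i k).const_mul _]
    exact Finset.sum_congr rfl fun k _ => integral_const_mul _ _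
  refine (hsum D _ (h.integrable_eval_mul C b)).trans (Eq.trans ?_ (hsum D _ hI).symm)
  exact Finset.sum_congr rfl fun i _ => Finset.sum_congr rfl fun k _ => by
    rw [integral_eval_mul_decay h]

/-- The rotation path `cos θ • A, sin θ • B` between two matrices of coefficients. -/
def rotMatrix (A : Matrix ι κ ℝ) (B : Matrix ι κ' ℝ) (θ : ℝ) : Matrix ι (κ ⊕ κ') ℝ :=
  Matrix.fromCols (Real.cos θ • A) (Real.sin θ • B)

/-- The derivative of `rotMatrix`. -/
def rotMatrixDeriv (A : Matrix ι κ ℝ) (B : Matrix ι κ' ℝ) (θ : ℝ) : Matrix ι (κ ⊕ κ') ℝ :=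
  Matrix.fromCols (-Real.sin θ • A) (Real.cos θ • B)

lemma hasDerivAt_rotMatrix_mulVec {ι κ κ' : Type*} [Fintype κ] [Fintype κ']
    (A : Matrix ι κ ℝ) (B : Matrix ι κ' ℝ) (g : κ ⊕ κ' → ℝ)
    (i : ι) (θ : ℝ) :
    HasDerivAt (fun θ => (rotMatrix A B θ).mulVec g i) ((rotMatrixDeriv A B θ).mulVec g i) θ := by
  simp only [rotMatrix, rotMatrixDeriv, Matrix.fromCols_mulVec, Matrix.smul_mulVec, Pi.add_apply,
    Pi.smul_apply, smul_eq_mul]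
  exact ((Real.hasDerivAt_cos θ).mul_const _).add ((Real.hasDerivAt_sin θ).mul_const _)

lemma rotMatrixDeriv_mul_transpose {ι κ κ' : Type*} [Fintype κ] [Fintype κ']
    (A : Matrix ι κ ℝ) (B : Matrix ι κ' ℝ) (θ : ℝ) :
    rotMatrixDeriv A B θ * (rotMatrix A B θ).transpose =
      (Real.sin θ * Real.cos θ) • (B * B.transpose - A * A.transpose) := by
  simp only [rotMatrix, rotMatrixDeriv, Matrix.transpose_fromCols, Matrix.fromCols_mul_fromRows,
    Matrix.transpose_smul, Matrix.smul_mul, Matrix.mul_smul, smul_smul, smul_sub]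
  rw [show Real.cos θ * -Real.sin θ = -(Real.sin θ * Real.cos θ) by ring, neg_smul]
  abel

lemma abs_mulVec_rotMatrixDeriv_le {ι κ κ' : Type*} [Fintype κ] [Fintype κ']
    (A : Matrix ι κ ℝ) (B : Matrix ι κ' ℝ) (g : κ ⊕ κ' → ℝ)
    (i : ι) (θ : ℝ) :
    |(rotMatrixDeriv A B θ).mulVec g i| ≤ ∑ k, |Matrix.fromCols A B i k| * |g k| := by
  refine (Finset.abs_sum_le_sum_abs _ _).trans (Finset.sum_le_sum fun k _ => ?_)
  rw [abs_mul]
  refine mul_le_mul_of_nonneg_right ?_ (abs_nonneg _)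
  rcases k with k | k
  · simp only [rotMatrixDeriv, Matrix.fromCols_apply_inl, Matrix.smul_apply, smul_eq_mul, abs_mul,
      abs_neg]
    exact mul_le_of_le_one_left (abs_nonneg _) (Real.abs_sin_le_one θ)
  · simp only [rotMatrixDeriv, Matrix.fromCols_apply_inr, Matrix.smul_apply, smul_eq_mul, abs_mul]
    exact mul_le_of_le_one_left (abs_nonneg _) (Real.abs_cos_le_one θ)

lemma integral_expSum_congr {φ : ℝ → ℝ} (hφ : Measurable φ) (C : Matrix ι κ ℝ)
    (C' : Matrix ι κ' ℝ) (b : ℝ) (h : C * C.transpose = C' * C'.transpose) :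
    ∫ g, φ (expSum C b g) ∂stdG κ = ∫ g, φ (expSum C' b g) ∂stdG κ' := by
  have hF : Measurable fun x : ι → ℝ => φ (∑ i, Real.exp (x i - b)) :=
    hφ.comp (Finset.measurable_fun_sum _ fun i _ => by fun_prop)
  have key := congrArg (fun μ => ∫ x, φ (∑ i, Real.exp (x i - b)) ∂μ) (map_mulVec_eq C C' h)
  rwa [integral_map (measurable_mulVec C).aemeasurable hF.aestronglyMeasurable,
    integral_map (measurable_mulVec C').aemeasurable hF.aestronglyMeasurable] at key

/-- Gaussian interpolation: expectations of `φ(s)` under two Gaussian laws with nearby covariance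
matrices are close. -/
lemma abs_integral_expSum_sub_le [Nonempty ι] {φ ψ ψ' : ℝ → ℝ} {K Δ : ℝ} (hφm : Measurable φ)
    (hφ : ∀ s, 0 < s → HasDerivAt φ (ψ s) s) (hφK : ∀ s, |φ s| ≤ K) (h : DecayBound ψ ψ' K)
    (A : Matrix ι κ ℝ) (B : Matrix ι κ' ℝ) (b : ℝ)
    (hΔ : ∀ i j, |(A * A.transpose) i j - (B * B.transpose) i j| ≤ Δ) :
    |∫ g, φ (expSum B b g) ∂stdG κ' - ∫ g, φ (expSum A b g) ∂stdG κ| ≤ 4 * K * Δ := by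
  have hψ := h.measurable
  have hψ' := h.measurable_deriv
  have hK0 : 0 ≤ K := (abs_nonneg _).trans (hφK 0)
  have hΔ0 : 0 ≤ Δ := (abs_nonneg _).trans (hΔ (Classical.arbitrary ι) (Classical.arbitrary ι))
  set G : ℝ → ℝ := fun θ => ∫ g, φ (expSum (rotMatrix A B θ) b g) ∂stdG (κ ⊕ κ') with hG
  have hderiv : ∀ θ, HasDerivAt G (∫ g, ψ (expSum (rotMatrix A B θ) b g) *
      ∑ i, (rotMatrixDeriv A B θ).mulVec g i * expWeight (rotMatrix A B θ) b i g
        ∂stdG (κ ⊕ κ')) θ := by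
    intro θ
    refine (hasDerivAt_integral_of_dominated_loc_of_deriv_le (s := Set.univ)
      (F := fun θ g => φ (expSum (rotMatrix A B θ) b g))
      (F' := fun θ g => ψ (expSum (rotMatrix A B θ) b g) *
        ∑ i, (rotMatrixDeriv A B θ).mulVec g i * expWeight (rotMatrix A B θ) b i g)
      (bound := fun g => ∑ i, (∑ k, |Matrix.fromCols A B i k| * |g k|) * K)
      Filter.univ_mem (Filter.Eventually.of_forall fun θ => ?_) ?_ ?_
      (ae_of_all _ fun g θ _ => ?_) ?_ (ae_of_all _ fun g θ _ => ?_)).2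
    · exact (hφm.comp (measurable_expSum _ b)).aestronglyMeasurable
    · exact Integrable.of_bound (hφm.comp (measurable_expSum _ b)).aestronglyMeasurable K
        (ae_of_all _ fun g => hφK _)
    · refine Measurable.aestronglyMeasurable ?_
      refine (hψ.comp (measurable_expSum _ b)).mul (Finset.measurable_fun_sum _ fun i _ => ?_)
      exact ((measurable_pi_apply i).comp (measurable_mulVec _)).mul (measurable_expWeight _ b i)
    · rw [Finset.mul_sum, Real.norm_eq_abs]
      refine (Finset.abs_sum_le_sum_abs _ _).trans (Finset.sum_le_sum fun i _ => ?_)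
      rw [mul_left_comm, abs_mul, abs_mul (ψ _), abs_of_pos (expWeight_pos _ b i g)]
      exact mul_le_mul (abs_mulVec_rotMatrixDeriv_le A B g i θ) (h.abs_mul_expWeight_le _ b i g)
        (mul_nonneg (abs_nonneg _) (expWeight_pos _ b i g).le)
        (Finset.sum_nonneg fun k _ => by positivity)
    · exact integrable_finsetSum _ fun i _ => (integrable_finsetSum _ fun k _ =>
        (integrable_eval_stdG k).abs.const_mul _).mul_const _
    · have hs : HasDerivAt (fun θ => expSum (rotMatrix A B θ) b g)
          (∑ i, (rotMatrixDeriv A B θ).mulVec g i * expWeight (rotMatrix A B θ) b i g) θ := by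
        refine HasDerivAt.fun_sum fun i _ => ?_
        exact (((hasDerivAt_rotMatrix_mulVec A B g i θ).sub_const b).exp).congr_deriv
          (by rw [expWeight, mul_comm])
      exact HasDerivAt.comp (h₂ := φ) θ (hφ _ (expSum_pos _ b g)) hs
  have hbound : ∀ θ, ‖∫ g, ψ (expSum (rotMatrix A B θ) b g) *
      ∑ i, (rotMatrixDeriv A B θ).mulVec g i * expWeight (rotMatrix A B θ) b i g
        ∂stdG (κ ⊕ κ')‖ ≤ 2 * K * Δ := by
    intro θ
    rw [integral_mulVec_mul_decay h, rotMatrixDeriv_mul_transpose]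
    have hentry : ∀ i j,
        |((Real.sin θ * Real.cos θ) • (B * B.transpose - A * A.transpose)) i j| ≤ Δ := by
      intro i j
      rw [Matrix.smul_apply, Matrix.sub_apply, smul_eq_mul, abs_mul, abs_mul, abs_sub_comm]
      refine (mul_le_of_le_one_left (abs_nonneg _) ?_).trans (hΔ i j)
      exact mul_le_one₀ (Real.abs_sin_le_one θ) (abs_nonneg _) (Real.abs_cos_le_one θ)
    set M := (Real.sin θ * Real.cos θ) • (B * B.transpose - A * A.transpose)
    set C := rotMatrix A B θ
    refine (norm_integral_le_of_norm_le_const (C := 2 * K * Δ) (ae_of_all _ fun g => ?_)).trans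
      (by simp)
    have hs := expSum_pos C b g
    rw [Real.norm_eq_abs]
    refine (abs_add_le _ _).trans ?_
    have h1 : |∑ i, ∑ j, M i j * (expWeight C b i g * expWeight C b j g)| ≤
        Δ * expSum C b g ^ 2 := by
      rw [sq]
      conv_rhs => rw [expSum, Finset.sum_mul_sum, Finset.mul_sum]
      refine (Finset.abs_sum_le_sum_abs _ _).trans (Finset.sum_le_sum fun i _ => ?_)
      rw [Finset.mul_sum]
      refine (Finset.abs_sum_le_sum_abs _ _).trans (Finset.sum_le_sum fun j _ => ?_)
      have := mul_pos (expWeight_pos C b i g) (expWeight_pos C b j g)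
      rw [abs_mul, abs_of_pos this]
      exact mul_le_mul_of_nonneg_right (hentry i j) this.le
    have h2 : |∑ i, M i i * expWeight C b i g| ≤ Δ * expSum C b g := by
      rw [expSum, Finset.mul_sum]
      refine (Finset.abs_sum_le_sum_abs _ _).trans (Finset.sum_le_sum fun i _ => ?_)
      rw [abs_mul, abs_of_pos (expWeight_pos C b i g)]
      exact mul_le_mul_of_nonneg_right (hentry i i) (expWeight_pos C b i g).le
    rw [abs_mul, abs_mul]
    have h3 := mul_le_mul_of_nonneg_left h1 (abs_nonneg (ψ' (expSum C b g)))
    have h4 := mul_le_mul_of_nonneg_left h2 (abs_nonneg (ψ (expSum C b g)))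
    have h5 := mul_le_mul_of_nonneg_left (h.bound_deriv _ hs) hΔ0
    have h6 := mul_le_mul_of_nonneg_left (h.bound _ hs) hΔ0
    nlinarith
  have hmv := (convex_univ (𝕜 := ℝ) (E := ℝ)).norm_image_sub_le_of_norm_hasDerivWithin_le
    (fun θ _ => (hderiv θ).hasDerivWithinAt) (fun θ _ => hbound θ)
    (Set.mem_univ 0) (Set.mem_univ (Real.pi / 2))
  have h0 : G 0 = ∫ g, φ (expSum A b g) ∂stdG κ := by
    refine integral_expSum_congr hφm _ _ b ?_
    simp [rotMatrix, Matrix.transpose_fromCols, Matrix.fromCols_mul_fromRows]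
  have h1 : G (Real.pi / 2) = ∫ g, φ (expSum B b g) ∂stdG κ' := by
    refine integral_expSum_congr hφm _ _ b ?_
    simp [rotMatrix, Matrix.transpose_fromCols, Matrix.fromCols_mul_fromRows]
  rw [h0, h1, sub_zero, Real.norm_eq_abs, Real.norm_eq_abs,
    abs_of_pos Real.pi_div_two_pos] at hmv
  refine hmv.trans ?_
  have : 0 ≤ K * Δ := by positivity
  nlinarith [Real.pi_le_four]

lemma decayBound_inv_one_add :
    DecayBound (fun s => (1 + s)⁻¹) (fun s => -((1 + s) ^ 2)⁻¹) 1 where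
  hasDerivAt s hs :=
    (((hasDerivAt_id s).const_add 1).inv (by simp; positivity)).congr_deriv
      (by simp [neg_div, one_div])
  measurable := by fun_prop
  measurable_deriv := by fun_prop
  bound s hs := by
    rw [abs_of_pos (by positivity), ← div_eq_mul_inv, div_le_one (by positivity)]
    linarith
  bound_deriv s hs := by
    rw [abs_neg, abs_of_pos (by positivity), ← div_eq_mul_inv, div_le_one (by positivity)]
    nlinarith

lemma map_mulVec_apply (A : Matrix ι κ ℝ) (i : ι) :
    (stdG κ).map (fun g => A.mulVec g i) =
      gaussianReal 0 ((A * A.transpose) i i).toNNReal := by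
  classical
  simpa [Pi.single_apply] using stdG_map_linear A (Pi.single i 1)

lemma integral_exp_mulVec (A : Matrix ι κ ℝ) (i : ι) :
    ∫ g, Real.exp (A.mulVec g i) ∂stdG κ = Real.exp ((A * A.transpose) i i / 2) := by
  have h0 : 0 ≤ (A * A.transpose) i i := by
    rw [Matrix.mul_apply]
    exact Finset.sum_nonneg fun k _ => mul_self_nonneg _
  have := mgf_gaussianReal (map_mulVec_apply A i) 1
  simpa [mgf, Real.coe_toNNReal _ h0] using this

lemma integrable_exp_mulVec (A : Matrix ι κ ℝ) (i : ι) :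
    Integrable (fun g => Real.exp (A.mulVec g i)) (stdG κ) :=
  Integrable.of_integral_ne_zero (by rw [integral_exp_mulVec]; positivity)

lemma sum_mul_expWeight_mul_le (A C : Matrix ι κ ℝ) (b : ℝ) (g : κ → ℝ) :
    ∑ i, ∑ j, (A * A.transpose) i j * (expWeight C b i g * expWeight C b j g) ≤
      expSum C b g * ∑ i, (A * A.transpose) i i * expWeight C b i g := by
  have e1 : ∑ i, ∑ j, (A * A.transpose) i j * (expWeight C b i g * expWeight C b j g) =
      ∑ k, (∑ i, A i k * expWeight C b i g) ^ 2 := by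
    simp only [sq, Finset.sum_mul_sum]
    rw [Finset.sum_comm (s := (Finset.univ : Finset κ))]
    refine Finset.sum_congr rfl fun i _ => ?_
    rw [Finset.sum_comm]
    refine Finset.sum_congr rfl fun j _ => ?_
    rw [Matrix.mul_apply, Finset.sum_mul]
    exact Finset.sum_congr rfl fun k _ => by rw [Matrix.transpose_apply]; ring
  have e2 : expSum C b g * ∑ i, (A * A.transpose) i i * expWeight C b i g =
      ∑ k, expSum C b g * ∑ i, A i k ^ 2 * expWeight C b i g := by
    rw [← Finset.mul_sum, Finset.sum_comm]
    congr 1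
    refine Finset.sum_congr rfl fun i _ => ?_
    rw [Matrix.mul_apply, Finset.sum_mul]
    exact Finset.sum_congr rfl fun k _ => by rw [Matrix.transpose_apply]; ring
  rw [e1, e2]
  refine Finset.sum_le_sum fun k _ => ?_
  refine Finset.sum_sq_le_sum_mul_sum_of_sq_le_mul _ (fun i _ => (expWeight_pos C b i g).le)
    (fun i _ => mul_nonneg (sq_nonneg _) (expWeight_pos C b i g).le) fun i _ => le_of_eq (by ring)

/-- Concentration function estimate for the soft maximum of a Gaussian vector. -/
lemma integral_expSum_div_le [Nonempty ι] {c0 C0 β : ℝ} (hβ : 0 < β) (A : Matrix ι κ ℝ) (b : ℝ)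
    (hc : ∀ i, c0 ≤ (A * A.transpose) i i) (hC : ∀ i, (A * A.transpose) i i ≤ C0) :
    β * c0 * ∫ g, expSum (β • A) b g / (1 + expSum (β • A) b g) ^ 2 ∂stdG κ ≤
      Real.log (1 + Fintype.card ι * Real.exp (C0 / 2)) := by
  have h := decayBound_inv_one_add
  set C := β • A with hCdef
  set T := A * A.transpose with hT
  have hAC : A * C.transpose = β • T := by
    rw [hCdef, Matrix.transpose_smul, Matrix.mul_smul]
  set c : ℝ := 1 + Fintype.card ι * Real.exp (C0 / 2) with hcdef
  have hc0 : 0 < c := by positivity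
  have key := integral_mulVec_mul_decay h C A b
  rw [hAC] at key
  have hInt : Integrable (fun g => -((1 + expSum C b g) ^ 2)⁻¹ *
      (∑ i, ∑ j, (β • T) i j * (expWeight C b i g * expWeight C b j g)) +
        (1 + expSum C b g)⁻¹ * ∑ i, (β • T) i i * expWeight C b i g) (stdG κ) := by
    refine Integrable.add ?_ ?_
    · simp only [Finset.mul_sum]
      refine integrable_finsetSum _ fun i _ => integrable_finsetSum _ fun j _ => ?_
      exact ((h.integrable_deriv_mul_expWeight C b i j).const_mul ((β • T) i j)).congr
        (ae_of_all _ fun g => by ring)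
    · simp only [Finset.mul_sum]
      refine integrable_finsetSum _ fun i _ => ?_
      exact ((h.integrable_mul_expWeight C b i).const_mul ((β • T) i i)).congr
        (ae_of_all _ fun g => by ring)
  have hInt' : Integrable (fun g => (1 + expSum C b g)⁻¹ *
      ∑ i, A.mulVec g i * expWeight C b i g) (stdG κ) := by
    simp only [Finset.mul_sum, Matrix.mulVec, dotProduct, Finset.sum_mul]
    refine integrable_finsetSum _ fun i _ => integrable_finsetSum _ fun k _ => ?_
    exact ((h.integrable_eval_mul C b i k).const_mul (A i k)).congr
      (ae_of_all _ fun g => by ring)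
  have hR : Integrable (fun g => Real.log c + ((1 + ∑ i, Real.exp (A.mulVec g i)) / c - 1))
      (stdG κ) :=
    (integrable_const _).add ((((integrable_const _).add
      (integrable_finsetSum _ fun i _ => integrable_exp_mulVec A i)).div_const _).sub
      (integrable_const _))
  have hq : Integrable (fun g => expSum C b g / (1 + expSum C b g) ^ 2) (stdG κ) := by
    refine Integrable.of_bound (Measurable.aestronglyMeasurable (by fun_prop)) 1
      (ae_of_all _ fun g => ?_)
    have := expSum_pos C b g
    rw [Real.norm_eq_abs, abs_of_pos (by positivity), div_le_one (by positivity)]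
    nlinarith
  calc β * c0 * ∫ g, expSum C b g / (1 + expSum C b g) ^ 2 ∂stdG κ
      = ∫ g, β * c0 * (expSum C b g / (1 + expSum C b g) ^ 2) ∂stdG κ :=
        (integral_const_mul _ _).symm
    _ ≤ ∫ g, -((1 + expSum C b g) ^ 2)⁻¹ *
        (∑ i, ∑ j, (β • T) i j * (expWeight C b i g * expWeight C b j g)) +
        (1 + expSum C b g)⁻¹ * ∑ i, (β • T) i i * expWeight C b i g ∂stdG κ := by
        refine integral_mono (hq.const_mul _) hInt fun g => ?_
        have hs := expSum_pos C b g
        have h1 := sum_mul_expWeight_mul_le A C b g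
        have h2 : c0 * expSum C b g ≤ ∑ i, T i i * expWeight C b i g := by
          rw [expSum, Finset.mul_sum]
          exact Finset.sum_le_sum fun i _ =>
            mul_le_mul_of_nonneg_right (hc i) (expWeight_pos C b i g).le
        simp only [Matrix.smul_apply, smul_eq_mul, mul_assoc, ← Finset.mul_sum]
        set s := expSum C b g
        set Q := ∑ i, ∑ j, T i j * (expWeight C b i g * expWeight C b j g)
        set V := ∑ i, T i i * expWeight C b i g
        have e : -((1 + s) ^ 2)⁻¹ * (β * Q) + (1 + s)⁻¹ * (β * V) =
            β * (((1 + s) * V - Q) / (1 + s) ^ 2) := by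
          field_simp; ring
        rw [e, ← mul_div_assoc c0]
        have h1' : Q ≤ s * V := h1
        gcongr
        linarith
    _ = ∫ g, (1 + expSum C b g)⁻¹ * ∑ i, A.mulVec g i * expWeight C b i g ∂stdG κ := key.symm
    _ ≤ ∫ g, Real.log c + ((1 + ∑ i, Real.exp (A.mulVec g i)) / c - 1) ∂stdG κ := by
        refine integral_mono hInt' hR fun g => ?_
        have hs := expSum_pos C b g
        set u := 1 + ∑ i, Real.exp (A.mulVec g i) with hu
        have hsum : 0 ≤ ∑ i, Real.exp (A.mulVec g i) :=
          Finset.sum_nonneg fun i _ => (Real.exp_pos _).le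
        have hu1 : 1 ≤ u := by linarith
        have hlog : Real.log u ≤ Real.log c + (u / c - 1) := by
          have := Real.log_le_sub_one_of_pos (x := u / c) (by positivity)
          rw [Real.log_div (by positivity) hc0.ne'] at this
          linarith
        refine le_trans ?_ hlog
        have h1 : ∑ i, A.mulVec g i * expWeight C b i g ≤ Real.log u * expSum C b g := by
          rw [expSum, Finset.mul_sum]
          refine Finset.sum_le_sum fun i _ =>
            mul_le_mul_of_nonneg_right ?_ (expWeight_pos C b i g).le
          rw [Real.le_log_iff_exp_le (by positivity)]
          have := Finset.single_le_sum (f := fun i => Real.exp (A.mulVec g i))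
            (fun j _ => (Real.exp_pos _).le) (Finset.mem_univ i)
          linarith
        have hl0 := Real.log_nonneg hu1
        rw [inv_mul_le_iff₀ (by positivity)]
        linarith
    _ ≤ Real.log c := by
        have hE : ∫ g, ∑ i, Real.exp (A.mulVec g i) ∂stdG κ ≤ c - 1 := by
          rw [integral_finsetSum _ fun i _ => integrable_exp_mulVec A i]
          simp only [integral_exp_mulVec]
          refine (Finset.sum_le_card_nsmul _ _ (Real.exp (C0 / 2)) fun i _ => ?_).trans ?_
          · exact Real.exp_le_exp.2 (by have := hC i; linarith)
          · simp [hcdef]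
        have hI := integrable_finsetSum (μ := stdG κ) Finset.univ
          fun i _ => integrable_exp_mulVec A i
        have hI1 : Integrable (fun g => 1 + ∑ i, Real.exp (A.mulVec g i)) (stdG κ) :=
          (integrable_const _).add hI
        have hI2 : Integrable (fun g => (1 + ∑ i, Real.exp (A.mulVec g i)) / c) (stdG κ) :=
          hI1.div_const c
        have hI3 : Integrable (fun g => (1 + ∑ i, Real.exp (A.mulVec g i)) / c - 1) (stdG κ) :=
          hI2.sub (integrable_const _)
        rw [integral_add (integrable_const _) hI3, integral_sub hI2 (integrable_const _),
          integral_div, integral_add (integrable_const _) hI]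
        simp only [integral_const, probReal_univ, one_smul]
        have : (1 + ∫ g, ∑ i, Real.exp (A.mulVec g i) ∂stdG κ) / c ≤ 1 := by
          rw [div_le_one hc0]; linarith
        linarith

/-- Anti-concentration of the soft maximum on a window of unit length. -/
lemma measureReal_expSum_window_le [Nonempty ι] {c0 C0 β : ℝ} (hc0 : 0 < c0) (hβ : 0 < β)
    (A : Matrix ι κ ℝ) (b : ℝ)
    (hc : ∀ i, c0 ≤ (A * A.transpose) i i) (hC : ∀ i, (A * A.transpose) i i ≤ C0) :
    (stdG κ).real {g | 1 ≤ expSum (β • A) b g ∧ expSum (β • A) b g ≤ Real.exp 1} ≤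
      16 * (Real.log (Fintype.card ι) + 1 + C0 / 2) / (β * c0) := by
  have hN : (1 : ℝ) ≤ Fintype.card ι := by exact_mod_cast Fintype.card_pos
  have hC0 : 0 ≤ C0 := by
    have i := Classical.arbitrary ι
    linarith [hc i, hC i]
  have h := integral_expSum_div_le hβ A b hc hC
  have hlog : Real.log (1 + Fintype.card ι * Real.exp (C0 / 2)) ≤
      Real.log (Fintype.card ι) + 1 + C0 / 2 := by
    have he : 1 ≤ Real.exp (C0 / 2) := Real.one_le_exp (by positivity)
    rw [Real.log_le_iff_le_exp (by positivity), Real.exp_add, Real.exp_add,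
      Real.exp_log (by positivity)]
    have := Real.add_one_le_exp (1 : ℝ)
    have h1 : 1 ≤ Fintype.card ι * Real.exp (C0 / 2) := one_le_mul_of_one_le_of_one_le hN he
    nlinarith
  have hq : Integrable (fun g => expSum (β • A) b g / (1 + expSum (β • A) b g) ^ 2) (stdG κ) := by
    refine Integrable.of_bound (Measurable.aestronglyMeasurable (by fun_prop)) 1
      (ae_of_all _ fun g => ?_)
    have := expSum_pos (β • A) b g
    rw [Real.norm_eq_abs, abs_of_pos (by positivity), div_le_one (by positivity)]
    nlinarith
  have hm := mul_meas_ge_le_integral_of_nonneg (ae_of_all _ fun g => by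
    have := expSum_pos (β • A) b g
    show 0 ≤ expSum (β • A) b g / (1 + expSum (β • A) b g) ^ 2
    positivity) hq (1 / 16)
  have hsub : (stdG κ).real {g | 1 ≤ expSum (β • A) b g ∧ expSum (β • A) b g ≤ Real.exp 1} ≤
      (stdG κ).real {g | 1 / 16 ≤ expSum (β • A) b g / (1 + expSum (β • A) b g) ^ 2} := by
    refine measureReal_mono fun g hg => ?_
    obtain ⟨h1, h2⟩ := hg
    have h3 : Real.exp 1 < 3 := by linarith [Real.exp_one_lt_d9]
    simp only [Set.mem_ofPred_eq]
    rw [div_le_div_iff₀ (by norm_num) (by positivity)]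
    nlinarith
  rw [le_div_iff₀ (by positivity)]
  have hbc : 0 < β * c0 := by positivity
  have h4 := mul_le_mul_of_nonneg_right hsub hbc.le
  have h5 := mul_le_mul_of_nonneg_right hm hbc.le
  nlinarith

lemma expSum_add (C : Matrix ι κ ℝ) (b t : ℝ) (g : κ → ℝ) :
    expSum C (b + t) g = expSum C b g * Real.exp (-t) := by
  simp only [expSum, expWeight, Finset.sum_mul, ← Real.exp_add]
  exact Finset.sum_congr rfl fun i _ => by ring_nf

lemma measureReal_expSum_windows_le [Nonempty ι] {c0 C0 β : ℝ} (hc0 : 0 < c0) (hβ : 0 < β)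
    (A : Matrix ι κ ℝ) (hc : ∀ i, c0 ≤ (A * A.transpose) i i)
    (hC : ∀ i, (A * A.transpose) i i ≤ C0) (m : ℕ) (b : ℝ) :
    (stdG κ).real {g | 1 < expSum (β • A) b g ∧ expSum (β • A) b g ≤ Real.exp m} ≤
      m * (16 * (Real.log (Fintype.card ι) + 1 + C0 / 2) / (β * c0)) := by
  induction m generalizing b with
  | zero =>
    have : {g : κ → ℝ | 1 < expSum (β • A) b g ∧ expSum (β • A) b g ≤ Real.exp (0 : ℕ)} = ∅ := by
      ext g; simp
    rw [this]; simp
  | succ m ih =>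
    have hsub : {g | 1 < expSum (β • A) b g ∧ expSum (β • A) b g ≤ Real.exp (m + 1 : ℕ)} ⊆
        {g | 1 ≤ expSum (β • A) b g ∧ expSum (β • A) b g ≤ Real.exp 1} ∪
        {g | 1 < expSum (β • A) (b + 1) g ∧ expSum (β • A) (b + 1) g ≤ Real.exp m} := by
      rintro g ⟨h1, h2⟩
      rcases le_or_gt (expSum (β • A) b g) (Real.exp 1) with h | h
      · exact Or.inl ⟨h1.le, h⟩
      · refine Or.inr ⟨?_, ?_⟩ <;> rw [expSum_add, Real.exp_neg, ← div_eq_mul_inv]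
        · rwa [lt_div_iff₀ (Real.exp_pos _), one_mul]
        · rw [div_le_iff₀ (Real.exp_pos _), ← Real.exp_add]
          exact_mod_cast h2
    refine (measureReal_mono hsub).trans ((measureReal_union_le _ _).trans ?_)
    have h1 := measureReal_expSum_window_le hc0 hβ A b hc hC
    have h2 := ih (b + 1)
    push_cast
    linarith

lemma measureReal_le_integral {Ω : Type*} [MeasurableSpace Ω] {P : Measure Ω}
    [IsProbabilityMeasure P] {f : Ω → ℝ} (hf : Measurable f) (h0 : ∀ ω, 0 ≤ f ω)
    (h1 : ∀ ω, f ω ≤ 1) {E : Set Ω} (hE : ∀ ω ∈ E, f ω = 1) : P.real E ≤ ∫ ω, f ω ∂P := by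
  have hInt : Integrable f P := Integrable.of_bound hf.aestronglyMeasurable 1
    (ae_of_all _ fun ω => by rw [Real.norm_eq_abs, abs_of_nonneg (h0 ω)]; exact h1 ω)
  have h := mul_meas_ge_le_integral_of_nonneg (ae_of_all _ h0) hInt 1
  rw [one_mul] at h
  exact (measureReal_mono fun ω hω => (hE ω hω).ge).trans h

lemma integral_le_measureReal {Ω : Type*} [MeasurableSpace Ω] {P : Measure Ω}
    [IsProbabilityMeasure P] {f : Ω → ℝ} (hf : Measurable f) (h0 : ∀ ω, 0 ≤ f ω)
    (h1 : ∀ ω, f ω ≤ 1) {E : Set Ω} (hE : ∀ ω ∉ E, f ω = 0) : ∫ ω, f ω ∂P ≤ P.real E := by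
  have hInt : Integrable f P := Integrable.of_bound hf.aestronglyMeasurable 1
    (ae_of_all _ fun ω => by rw [Real.norm_eq_abs, abs_of_nonneg (h0 ω)]; exact h1 ω)
  have h := measureReal_le_integral (P := P) (f := fun ω => 1 - f ω) (E := Eᶜ) (by fun_prop)
    (fun ω => sub_nonneg.2 (h1 ω)) (fun ω => by linarith [h0 ω]) fun ω hω => by
      rw [hE ω hω, sub_zero]
  rw [integral_sub (integrable_const _) hInt] at h
  have hu := measureReal_union_le (μ := P) E Eᶜ
  simp only [Set.union_compl_self, probReal_univ, integral_const, smul_eq_mul, mul_one] at h hu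
  linarith

/-- A smooth cutoff equal to `1` on `(-∞, 1]` and to `0` on `[2, ∞)`. -/
lemma exists_cutoff : ∃ (φ ψ ψ' : ℝ → ℝ) (K : ℝ), 0 < K ∧ Measurable φ ∧
    (∀ s, HasDerivAt φ (ψ s) s) ∧ DecayBound ψ ψ' K ∧ (∀ s, 0 ≤ φ s) ∧ (∀ s, φ s ≤ 1) ∧
    (∀ s, |φ s| ≤ K) ∧ (∀ s ≤ 1, φ s = 1) ∧ ∀ s, 2 ≤ s → φ s = 0 := by
  set φ : ℝ → ℝ := fun s => Real.smoothTransition (2 - s) with hφ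
  have hsmooth : ContDiff ℝ 2 φ :=
    Real.smoothTransition.contDiff.comp (contDiff_const.sub contDiff_id)
  have hsmooth' : ContDiff ℝ 1 (deriv φ) := by
    have : ContDiff ℝ (1 + 1) φ := by convert hsmooth; norm_num
    exact (contDiff_succ_iff_deriv.1 this).2.2
  have h1 : ∀ s ≤ 1, φ s = 1 := fun s hs =>
    Real.smoothTransition.one_of_one_le (by linarith)
  have h2 : ∀ s, 2 ≤ s → φ s = 0 := fun s hs =>
    Real.smoothTransition.zero_of_nonpos (by linarith)
  have hsupp : HasCompactSupport (deriv φ) := by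
    refine HasCompactSupport.intro (isCompact_Icc (a := (1 : ℝ)) (b := 2)) fun s hs => ?_
    rw [Set.mem_Icc, not_and_or, not_le, not_le] at hs
    rcases hs with hs | hs
    · have : φ =ᶠ[nhds s] fun _ => 1 := by
        filter_upwards [Iio_mem_nhds hs] with t ht using h1 t (le_of_lt ht)
      rw [this.deriv_eq, deriv_const]
    · have : φ =ᶠ[nhds s] fun _ => 0 := by
        filter_upwards [Ioi_mem_nhds hs] with t ht using h2 t (le_of_lt ht)
      rw [this.deriv_eq, deriv_const]
  have hc : Continuous (deriv φ) := hsmooth'.continuous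
  have hc' : Continuous (deriv (deriv φ)) := hsmooth'.continuous_deriv le_rfl
  obtain ⟨K₁, hK₁⟩ := (continuous_id.mul hc).bounded_above_of_compact_support hsupp.mul_left
  obtain ⟨K₂, hK₂⟩ := ((continuous_id.pow 2).mul hc').bounded_above_of_compact_support
    hsupp.deriv.mul_left
  refine ⟨φ, deriv φ, deriv (deriv φ), max 1 (max K₁ K₂), by positivity,
    hsmooth.continuous.measurable,
    fun s => (hsmooth.differentiable (by norm_num) s).hasDerivAt,
    ⟨fun s _ => (hsmooth'.differentiable (by norm_num) s).hasDerivAt, hc.measurable,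
      hc'.measurable, fun s hs => ?_, fun s hs => ?_⟩,
    fun s => Real.smoothTransition.nonneg _, fun s => Real.smoothTransition.le_one _,
    fun s => ?_, h1, h2⟩
  · have := hK₁ s
    simp only [Pi.mul_apply, id, norm_mul, Real.norm_eq_abs, abs_of_pos hs] at this
    exact this.trans (le_max_of_le_right (le_max_left _ _))
  · have := hK₂ s
    simp only [Pi.mul_apply, Pi.pow_apply, id, norm_mul, norm_pow, Real.norm_eq_abs,
      abs_of_pos hs] at this
    exact this.trans (le_max_of_le_right (le_max_right _ _))
  · rw [abs_of_nonneg (Real.smoothTransition.nonneg _)]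
    exact (Real.smoothTransition.le_one _).trans (le_max_left _ _)

lemma le_of_expSum_smul_le_one {C : Matrix ι κ ℝ} {β x : ℝ} (hβ : 0 < β) {g : κ → ℝ}
    (h : expSum (β • C) (β * x) g ≤ 1) (i : ι) : C.mulVec g i ≤ x := by
  have := (expWeight_le_expSum (β • C) (β * x) i g).trans h
  rw [expWeight, Real.exp_le_one_iff, Matrix.smul_mulVec, Pi.smul_apply, smul_eq_mul] at this
  nlinarith

lemma expSum_smul_le_card {C : Matrix ι κ ℝ} {β x : ℝ} (hβ : 0 < β) {g : κ → ℝ}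
    (h : ∀ i, C.mulVec g i ≤ x) : expSum (β • C) (β * x) g ≤ Fintype.card ι := by
  have hle : ∀ i, expWeight (β • C) (β * x) i g ≤ 1 := fun i => by
    rw [expWeight, Real.exp_le_one_iff, Matrix.smul_mulVec, Pi.smul_apply, smul_eq_mul]
    nlinarith [h i]
  simpa [expSum] using Finset.sum_le_sum fun i (_ : i ∈ Finset.univ) => hle i

/-- Comparison of the maxima of two Gaussian vectors, before optimizing the smoothing
parameter `β`. -/
lemma abs_measureReal_sub_le_of_smoothing [Nonempty ι] {c0 C0 : ℝ} (hc0 : 0 < c0)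
    {φ ψ ψ' : ℝ → ℝ} {K : ℝ}
    (hφm : Measurable φ) (hφ : ∀ s, HasDerivAt φ (ψ s) s) (hψ : DecayBound ψ ψ' K)
    (hφ0 : ∀ s, 0 ≤ φ s) (hφ1 : ∀ s, φ s ≤ 1) (hφK : ∀ s, |φ s| ≤ K)
    (hone : ∀ s ≤ 1, φ s = 1) (hzero : ∀ s, 2 ≤ s → φ s = 0)
    (A : Matrix ι κ ℝ) (B : Matrix ι κ' ℝ) {Δ : ℝ}
    (hc : ∀ i, c0 ≤ (A * A.transpose) i i) (hC : ∀ i, (A * A.transpose) i i ≤ C0)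
    (hΔ : ∀ i j, |(A * A.transpose) i j - (B * B.transpose) i j| ≤ Δ)
    {β : ℝ} (hβ : 0 < β) (x : ℝ) :
    |(stdG κ).real {g | ∀ i, A.mulVec g i ≤ x} - (stdG κ').real {g | ∀ i, B.mulVec g i ≤ x}| ≤
      4 * K * Δ * β ^ 2 + (Real.log (Fintype.card ι) + 2) *
        (16 * (Real.log (Fintype.card ι) + 1 + C0 / 2) / (β * c0)) := by
  set N : ℝ := (Fintype.card ι : ℝ) with hN
  have hN1 : 1 ≤ N := by rw [hN]; exact_mod_cast Fintype.card_pos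
  have hL : 0 ≤ Real.log N := Real.log_nonneg hN1
  have hC0 : 0 ≤ C0 := by
    have i := Classical.arbitrary ι
    linarith [hc i, hC i]
  have hinterp : ∀ b, |∫ g, φ (expSum (β • B) b g) ∂stdG κ' -
      ∫ g, φ (expSum (β • A) b g) ∂stdG κ| ≤ 4 * K * Δ * β ^ 2 := by
    intro b
    refine (abs_integral_expSum_sub_le (Δ := β ^ 2 * Δ) hφm (fun s _ => hφ s) hφK hψ
      (β • A) (β • B) b fun i j => ?_).trans (le_of_eq (by ring))
    simp only [Matrix.transpose_smul, Matrix.smul_mul, Matrix.mul_smul, Matrix.smul_apply,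
      smul_eq_mul]
    rw [← mul_sub, ← mul_sub, ← mul_assoc, ← sq, abs_mul, abs_of_pos (pow_pos hβ 2)]
    exact mul_le_mul_of_nonneg_left (hΔ i j) (by positivity)
  set m : ℕ := ⌈Real.log N + 1⌉₊
  have hm : Real.log N + 1 ≤ m := Nat.le_ceil _
  have hm' : (m : ℝ) ≤ Real.log N + 2 := by
    have := Nat.ceil_lt_add_one (a := Real.log N + 1) (by linarith)
    linarith
  have hexp : 2 * N ≤ Real.exp m := by
    have h1 := Real.exp_le_exp.2 hm
    rw [Real.exp_add, Real.exp_log (by linarith)] at h1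
    have h2 := Real.add_one_le_exp (1 : ℝ)
    nlinarith
  have hwin : ∀ b, (stdG κ).real {g | 1 < expSum (β • A) b g ∧
      expSum (β • A) b g ≤ Real.exp m} ≤ (Real.log N + 2) *
        (16 * (Real.log N + 1 + C0 / 2) / (β * c0)) := fun b =>
    (measureReal_expSum_windows_le hc0 hβ A hc hC m b).trans
      (mul_le_mul_of_nonneg_right hm' (by positivity))
  rw [abs_le]
  constructor
  · have h1 : (stdG κ').real {g | ∀ i, B.mulVec g i ≤ x} ≤
        ∫ g, φ (expSum (β • B) (β * x + Real.log N) g) ∂stdG κ' := by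
      refine measureReal_le_integral (hφm.comp (measurable_expSum _ _)) (fun _ => hφ0 _) (fun _ => hφ1 _)
        fun g hg => hone _ ?_
      rw [expSum_add, Real.exp_neg, Real.exp_log (by linarith), ← div_eq_mul_inv,
        div_le_one (by linarith)]
      exact expSum_smul_le_card hβ hg
    have h2 : ∫ g, φ (expSum (β • A) (β * x + Real.log N) g) ∂stdG κ ≤
        (stdG κ).real ({g | ∀ i, A.mulVec g i ≤ x} ∪
          {g | 1 < expSum (β • A) (β * x) g ∧ expSum (β • A) (β * x) g ≤ Real.exp m}) := by
      refine integral_le_measureReal (hφm.comp (measurable_expSum _ _)) (fun _ => hφ0 _) (fun _ => hφ1 _)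
        fun g hg => hzero _ ?_
      rw [Set.mem_union, not_or] at hg
      obtain ⟨hg1, hg2⟩ := hg
      have h3 : 1 < expSum (β • A) (β * x) g := by
        by_contra! h
        exact hg1 (le_of_expSum_smul_le_one hβ h)
      have h4 : Real.exp m < expSum (β • A) (β * x) g := by
        by_contra! h
        exact hg2 ⟨h3, h⟩
      rw [expSum_add, Real.exp_neg, Real.exp_log (by linarith), ← div_eq_mul_inv,
        le_div_iff₀ (by linarith)]
      linarith
    have h3 := measureReal_union_le (μ := stdG κ) {g | ∀ i, A.mulVec g i ≤ x}
      {g | 1 < expSum (β • A) (β * x) g ∧ expSum (β • A) (β * x) g ≤ Real.exp m}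
    have h4 := hwin (β * x)
    have h5 := (abs_le.1 (hinterp (β * x + Real.log N))).2
    linarith
  · have h1 : ∫ g, φ (expSum (β • B) (β * x + -Real.log 2) g) ∂stdG κ' ≤
        (stdG κ').real {g | ∀ i, B.mulVec g i ≤ x} := by
      refine integral_le_measureReal (hφm.comp (measurable_expSum _ _)) (fun _ => hφ0 _) (fun _ => hφ1 _)
        fun g hg => hzero _ ?_
      rw [expSum_add, neg_neg, Real.exp_log (by norm_num)]
      have : 1 < expSum (β • B) (β * x) g := by
        by_contra! h
        exact hg (le_of_expSum_smul_le_one hβ h)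
      linarith
    have h2 : (stdG κ).real ({g | ∀ i, A.mulVec g i ≤ x} \
          {g | 1 < expSum (β • A) (β * x + -Real.log 2) g ∧
            expSum (β • A) (β * x + -Real.log 2) g ≤ Real.exp m}) ≤
        ∫ g, φ (expSum (β • A) (β * x + -Real.log 2) g) ∂stdG κ := by
      refine measureReal_le_integral (hφm.comp (measurable_expSum _ _)) (fun _ => hφ0 _) (fun _ => hφ1 _)
        fun g hg => hone _ ?_
      by_contra! h
      refine hg.2 ⟨h, ?_⟩
      rw [expSum_add, neg_neg, Real.exp_log (by norm_num)]
      have := expSum_smul_le_card hβ hg.1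
      linarith
    have h3 := measureReal_union_le (μ := stdG κ) ({g | ∀ i, A.mulVec g i ≤ x} \
          {g | 1 < expSum (β • A) (β * x + -Real.log 2) g ∧
            expSum (β • A) (β * x + -Real.log 2) g ≤ Real.exp m})
          {g | 1 < expSum (β • A) (β * x + -Real.log 2) g ∧
            expSum (β • A) (β * x + -Real.log 2) g ≤ Real.exp m}
    rw [Set.sdiff_union_self] at h3
    have h3' := measureReal_mono (μ := stdG κ) (Set.subset_union_left
      (s := {g | ∀ i, A.mulVec g i ≤ x})
      (t := {g | 1 < expSum (β • A) (β * x + -Real.log 2) g ∧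
            expSum (β • A) (β * x + -Real.log 2) g ≤ Real.exp m}))
    have h4 := hwin (β * x + -Real.log 2)
    have h5 := (abs_le.1 (hinterp (β * x + -Real.log 2))).1
    linarith

/-- Comparison of the maxima of two Gaussian vectors given as linear images of standard ones. -/
lemma exists_abs_measureReal_mulVec_sub_le : ∃ K : ℝ, 0 < K ∧
    ∀ {ι κ κ' : Type} [Fintype ι] [Fintype κ] [Fintype κ'] [Nonempty ι] {c0 C0 : ℝ}, 0 < c0 →
    ∀ (A : Matrix ι κ ℝ) (B : Matrix ι κ' ℝ) {Δ : ℝ},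
    (∀ i, c0 ≤ (A * A.transpose) i i) → (∀ i, (A * A.transpose) i i ≤ C0) →
    (∀ i j, |(A * A.transpose) i j - (B * B.transpose) i j| ≤ Δ) → ∀ x : ℝ,
    |(stdG κ).real {g | ∀ i, A.mulVec g i ≤ x} - (stdG κ').real {g | ∀ i, B.mulVec g i ≤ x}| ≤
      Δ ^ ((1 : ℝ) / 3) * (4 * K + (Real.log (Fintype.card ι) + 2) *
        (16 * (Real.log (Fintype.card ι) + 1 + C0 / 2) / c0)) := by
  obtain ⟨φ, ψ, ψ', K, hK, hφm, hφ, hψ, hφ0, hφ1, hφK, hone, hzero⟩ := exists_cutoff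
  refine ⟨K, hK, fun {ι κ κ'} _ _ _ _ c0 C0 hc0 A B Δ hc hC hΔ x => ?_⟩
  have key := fun β (hβ : 0 < β) => abs_measureReal_sub_le_of_smoothing hc0 hφm hφ hψ hφ0 hφ1
    hφK hone hzero A B hc hC hΔ (β := β) hβ x
  have i := Classical.arbitrary ι
  have hΔ0 : 0 ≤ Δ := (abs_nonneg _).trans (hΔ i i)
  set D := |(stdG κ).real {g | ∀ i, A.mulVec g i ≤ x} -
    (stdG κ').real {g | ∀ i, B.mulVec g i ≤ x}|
  set L := Real.log (Fintype.card ι)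
  have e : ∀ β, (L + 2) * (16 * (L + 1 + C0 / 2) / (β * c0)) =
      β⁻¹ * ((L + 2) * (16 * (L + 1 + C0 / 2) / c0)) := fun β => by
    rw [mul_comm β, ← div_div]; ring
  set W := (L + 2) * (16 * (L + 1 + C0 / 2) / c0)
  rcases hΔ0.eq_or_lt with h0 | h0
  · rw [← h0, Real.zero_rpow (by norm_num), zero_mul]
    have hlim : Filter.Tendsto (fun β : ℝ => β⁻¹ * W) Filter.atTop (nhds 0) := by
      simpa using tendsto_inv_atTop_zero.mul_const W
    refine ge_of_tendsto hlim ?_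
    filter_upwards [Filter.eventually_gt_atTop 0] with β hβ
    have := key β hβ
    rw [e, ← h0] at this
    linarith
  · set d := Δ ^ ((1 : ℝ) / 3) with hd
    have hd0 : 0 < d := Real.rpow_pos_of_pos h0 _
    have hd3 : d ^ 3 = Δ := by
      rw [hd, ← Real.rpow_natCast, ← Real.rpow_mul hΔ0]; norm_num
    have := key d⁻¹ (inv_pos.2 hd0)
    rw [e, ← hd3] at this
    refine this.trans (le_of_eq ?_)
    field_simp

lemma sum_single_add_single [DecidableEq ι] (M : Matrix ι ι ℝ) (i j : ι) (s : ℝ) :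
    ∑ k, ∑ l, (Pi.single i 1 + Pi.single j s : ι → ℝ) k * (Pi.single i 1 + Pi.single j s : ι → ℝ) l
      * M k l = M i i + s * M i j + s * M j i + s ^ 2 * M j j := by
  simp only [Pi.add_apply, add_mul, mul_add, Finset.sum_add_distrib, Pi.single_apply, ite_mul,
    mul_ite, zero_mul, mul_zero, one_mul, mul_one, Finset.sum_ite_eq', Finset.mem_univ, if_true]
  ring

/-- If the quadratic form of a Gram matrix is the positive part of that of `S`, and `S` has
nonnegative diagonal, then the Gram matrix is the symmetric part of `S`. -/
lemma mul_transpose_apply_of_quadratic_eq {S : Matrix ι ι ℝ} {C : Matrix ι κ ℝ}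
    (hS : ∀ i, 0 ≤ S i i)
    (h : ∀ a : ι → ℝ, ∑ i, ∑ j, a i * a j * (C * C.transpose) i j =
      max (∑ i, ∑ j, a i * a j * S i j) 0) (i j : ι) :
    (C * C.transpose) i j = (S i j + S j i) / 2 := by
  classical
  have hdiag : ∀ i, (C * C.transpose) i i = S i i := fun i => by
    simpa [Pi.single_apply, hS i] using h (Pi.single i 1)
  have hsymm : (C * C.transpose) j i = (C * C.transpose) i j := by
    simp only [Matrix.mul_apply, Matrix.transpose_apply, mul_comm]
  have h1 := h (Pi.single i 1 + Pi.single j 1)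
  have h2 := h (Pi.single i 1 + Pi.single j (-1))
  rw [sum_single_add_single, sum_single_add_single, hdiag, hdiag, hsymm] at h1 h2
  rcases max_cases (S i i + 1 * S i j + 1 * S j i + 1 ^ 2 * S j j) 0 with ⟨e1, l1⟩ | ⟨e1, l1⟩ <;>
  rcases max_cases (S i i + -1 * S i j + -1 * S j i + (-1) ^ 2 * S j j) 0 with
    ⟨e2, l2⟩ | ⟨e2, l2⟩ <;> rw [e1] at h1 <;> rw [e2] at h2 <;> linarith

open scoped MatrixOrder ComplexOrder in
lemma exists_eq_mul_transpose_of_posSemidef {M : Matrix ι ι ℝ} (h : M.PosSemidef) :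
    ∃ C : Matrix ι ι ℝ, M = C * C.transpose := by
  classical
  obtain ⟨B, hB⟩ := CStarAlgebra.nonneg_iff_eq_star_mul_self.1 h.nonneg
  exact ⟨B.transpose, by
    rw [hB, Matrix.transpose_transpose, Matrix.star_eq_conjTranspose,
      Matrix.conjTranspose_eq_transpose_of_trivial]⟩

/-- A random vector all of whose linear combinations are centered Gaussian is distributed as a
linear image of a standard Gaussian vector. -/
lemma exists_map_eq_map_mulVec {Ω : Type*} [MeasurableSpace Ω] {P : Measure Ω}
    [IsProbabilityMeasure P] (X : ι → Ω → ℝ) (hX : ∀ i, Measurable (X i)) (S : Matrix ι ι ℝ)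
    (h : ∀ a : ι → ℝ, P.map (fun ω => ∑ i, a i * X i ω) =
      gaussianReal 0 (∑ i, ∑ j, a i * a j * S i j).toNNReal) :
    ∃ C : Matrix ι ι ℝ, P.map (fun ω i => X i ω) = (stdG ι).map (fun g => C.mulVec g) ∧
      ∀ a : ι → ℝ, ∑ i, ∑ j, a i * a j * (C * C.transpose) i j =
        max (∑ i, ∑ j, a i * a j * S i j) 0 := by
  classical
  have hm : ∀ a : ι → ℝ, Measurable fun ω => ∑ i, a i * X i ω := fun a => by fun_prop
  have hL2 : ∀ i, MemLp (X i) 2 P := by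
    intro i
    have h1 := memLp_id_gaussianReal (μ := 0)
      (v := (∑ k, ∑ j, (Pi.single i 1 : ι → ℝ) k * (Pi.single i 1 : ι → ℝ) j * S k j).toNNReal) 2
    rw [← h, memLp_map_measure_iff aestronglyMeasurable_id (hm _).aemeasurable] at h1
    simpa [Function.comp_def, Pi.single_apply] using h1
  set T : Matrix ι ι ℝ := Matrix.of fun i j => ∫ ω, X i ω * X j ω ∂P with hT
  have hquad : ∀ a : ι → ℝ, ∑ i, ∑ j, a i * a j * T i j =
      max (∑ i, ∑ j, a i * a j * S i j) 0 := by
    intro a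
    have h1 : ∫ ω, (∑ i, a i * X i ω) ^ 2 ∂P = max (∑ i, ∑ j, a i * a j * S i j) 0 := by
      rw [← integral_map (φ := fun ω => ∑ i, a i * X i ω) (f := fun y : ℝ => y ^ 2)
        (hm a).aemeasurable (by fun_prop), h]
      have h2 := variance_id_gaussianReal (μ := 0)
        (v := (∑ i, ∑ j, a i * a j * S i j).toNNReal)
      rw [variance_of_integral_eq_zero aemeasurable_id (by simp)] at h2
      simpa using h2
    have hInt : ∀ i j, Integrable (fun ω => X i ω * X j ω) P := fun i j =>
      (hL2 i).integrable_mul (hL2 j)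
    have hInt' : ∀ i j, Integrable (fun ω => a i * X i ω * (a j * X j ω)) P := fun i j =>
      ((hInt i j).const_mul (a i * a j)).congr (ae_of_all _ fun ω => by ring)
    rw [← h1]
    simp only [sq, Finset.sum_mul_sum]
    rw [integral_finsetSum _ fun i _ => integrable_finsetSum _ fun j _ => hInt' i j]
    refine Finset.sum_congr rfl fun i _ => ?_
    rw [integral_finsetSum _ fun j _ => hInt' i j]
    refine Finset.sum_congr rfl fun j _ => ?_
    rw [hT, Matrix.of_apply, ← integral_const_mul]
    exact integral_congr_ae (ae_of_all _ fun ω => by ring)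
  have hpos : T.PosSemidef := by
    refine Matrix.posSemidef_iff_dotProduct_mulVec.2 ⟨?_, fun a => ?_⟩
    · ext i j
      simp [hT, mul_comm]
    · have : star a ⬝ᵥ T.mulVec a = ∑ i, ∑ j, a i * a j * T i j := by
        simp only [dotProduct, Matrix.mulVec, Finset.mul_sum, star_trivial]
        exact Finset.sum_congr rfl fun i _ => Finset.sum_congr rfl fun j _ => by ring
      rw [this, hquad]
      exact le_max_right _ _
  obtain ⟨C, hC⟩ := exists_eq_mul_transpose_of_posSemidef hpos
  rw [hC] at hquad
  refine ⟨C, map_eq_of_linear X hX C fun a => ?_, hquad⟩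
  rw [h, hquad]
  congr 1
  ext
  simp

lemma measureReal_abs_le_eq {Ω : Type*} [MeasurableSpace Ω] {P : Measure Ω} {X : ι → Ω → ℝ}
    (hX : ∀ i, Measurable (X i)) {C : Matrix ι κ ℝ}
    (h : P.map (fun ω i => X i ω) = (stdG κ).map (fun g => C.mulVec g)) (x : ℝ) :
    (P {ω | ∀ i, |X i ω| ≤ x}).toReal =
      (stdG κ).real {g | ∀ i, (Matrix.fromRows C (-C)).mulVec g i ≤ x} := by
  have hs : MeasurableSet {y : ι → ℝ | ∀ i, |y i| ≤ x} := by measurability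
  have h1 := congrArg (fun Q => (Q {y : ι → ℝ | ∀ i, |y i| ≤ x}).toReal) h
  beta_reduce at h1
  rw [Measure.map_apply (by fun_prop) hs, Measure.map_apply (by fun_prop) hs] at h1
  refine h1.trans ?_
  rw [Measure.real]
  congr 2
  ext g
  simp only [Set.mem_preimage, Set.mem_ofPred_eq, Sum.forall, Matrix.fromRows_mulVec,
    Sum.elim_inl, Sum.elim_inr, Matrix.neg_mulVec, Pi.neg_apply, abs_le', forall_and]

lemma fromRows_neg_mul_transpose_apply {ι : Type*} (i j : ι ⊕ ι) :
    ∃ s : ℝ, |s| = 1 ∧ (i = j → s = 1) ∧ ∀ {κ : Type*} [Fintype κ] (C : Matrix ι κ ℝ),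
      (Matrix.fromRows C (-C) * (Matrix.fromRows C (-C)).transpose) i j =
        s * (C * C.transpose) (Sum.elim id id i) (Sum.elim id id j) := by
  rcases i with i | i <;> rcases j with j | j
  · exact ⟨1, by simp, by simp, fun C => by simp [Matrix.transpose_fromRows]⟩
  · exact ⟨-1, by simp, by simp, fun C => by simp [Matrix.transpose_fromRows]⟩
  · exact ⟨-1, by simp, by simp, fun C => by simp [Matrix.transpose_fromRows]⟩
  · exact ⟨1, by simp, by simp, fun C => by simp [Matrix.transpose_fromRows]⟩

/-- **Gaussian comparison inequality for maxima of absolute values**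
(Lemma 2, part 2, of Zhang–Politis): if `(ε_1,…,ε_n)` is centered Gaussian with nonsingular
covariance `Σ` (diagonal in `[c₀, C₀]`), `(ξ_1,…,ξ_n)` is centered Gaussian with possibly
singular covariance `Σ*`, and `Δ = max_{i,j}|σ_{ij} − σ*_{ij}| < 1`, then for all `n ≥ 1`,
`sup_x |P(max_i |ε_i| ≤ x) − P(max_i |ξ_i| ≤ x)|
  ≤ C* (Δ^{1/3}(1 + log³ n) + Δ^{1/6}/(1 + log^{1/4} n))`,
where `C*` depends only on `c₀` and `C₀`. -/
theorem gaussian_comparison (c0 C0 : ℝ) (h_c0 : 0 < c0) (h_C0 : c0 ≤ C0) :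
    ∃ Cstar : ℝ, 0 < Cstar ∧
      ∀ (n : ℕ), 1 ≤ n →
      ∀ (Ω Ω' : Type) (_ : MeasureSpace Ω) (_ : MeasureSpace Ω'),
        IsProbabilityMeasure (volume : Measure Ω) →
        IsProbabilityMeasure (volume : Measure Ω') →
        ∀ (ξ : Fin n → Ω → ℝ) (ζ : Fin n → Ω' → ℝ)
          (S Sstar : Matrix (Fin n) (Fin n) ℝ) (Δ : ℝ),
        (∀ i, Measurable (ξ i)) → (∀ i, Measurable (ζ i)) →
        -- ε centered Gaussian with covariance S, nonsingular, bounded diagonal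
        (∀ a : Fin n → ℝ,
          Measure.map (fun ω => ∑ i, a i * ξ i ω) volume =
            gaussianReal 0 (Real.toNNReal (∑ i, ∑ j, a i * a j * S i j))) →
        S.det ≠ 0 →
        (∀ i, c0 ≤ S i i ∧ S i i ≤ C0) →
        -- ξ centered Gaussian with (possibly singular) PSD covariance S*
        Sstar.PosSemidef →
        (∀ a : Fin n → ℝ,
          Measure.map (fun ω => ∑ i, a i * ζ i ω) volume =
            gaussianReal 0 (Real.toNNReal (∑ i, ∑ j, a i * a j * Sstar i j))) →
        -- Δ bounds the entrywise covariance discrepancy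
        (∀ i j, |S i j - Sstar i j| ≤ Δ) → Δ < 1 →
        ∀ x : ℝ,
          |(volume {ω : Ω | ∀ i, |ξ i ω| ≤ x}).toReal
              - (volume {ω : Ω' | ∀ i, |ζ i ω| ≤ x}).toReal| ≤
            Cstar * (Δ ^ ((1 : ℝ) / 3) * (1 + Real.log n ^ 3)
              + Δ ^ ((1 : ℝ) / 6) / (1 + Real.log n ^ ((1 : ℝ) / 4))) := by
  obtain ⟨K, hK, hmain⟩ := exists_abs_measureReal_mulVec_sub_le
  have hC0 : 0 ≤ C0 := h_c0.le.trans h_C0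
  refine ⟨4 * K + 16 * (12 + 2 * C0) / c0, by positivity, ?_⟩
  intro n hn Ω Ω' _ _ _ _ ξ ζ S Sstar Δ hξ hζ hS _ hdiag hpos hSstar hΔ _ x
  have : Nonempty (Fin n) := ⟨⟨0, hn⟩⟩
  have hΔ0 : 0 ≤ Δ := (abs_nonneg _).trans (hΔ ⟨0, hn⟩ ⟨0, hn⟩)
  obtain ⟨A, hA, hAq⟩ := exists_map_eq_map_mulVec ξ hξ S hS
  obtain ⟨B, hB, hBq⟩ := exists_map_eq_map_mulVec ζ hζ Sstar hSstar
  have hA' := mul_transpose_apply_of_quadratic_eq (fun i => h_c0.le.trans (hdiag i).1) hAq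
  have hB' := mul_transpose_apply_of_quadratic_eq (fun i => hpos.diag_nonneg) hBq
  have hAd : ∀ i, (A * A.transpose) i i = S i i := fun i => by rw [hA']; ring
  have hAB : ∀ i j, |(A * A.transpose) i j - (B * B.transpose) i j| ≤ Δ := fun i j => by
    rw [hA', hB', abs_le]
    have h1 := abs_le.1 (hΔ i j)
    have h2 := abs_le.1 (hΔ j i)
    constructor <;> linarith [h1.1, h1.2, h2.1, h2.2]
  have hAd' : ∀ i, (Matrix.fromRows A (-A) * (Matrix.fromRows A (-A)).transpose) i i =
      S (Sum.elim id id i) (Sum.elim id id i) := fun i => by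
    obtain ⟨s, -, hs, h⟩ := fromRows_neg_mul_transpose_apply i i
    rw [h, hs rfl, one_mul, hAd]
  have key := hmain h_c0 (Matrix.fromRows A (-A)) (Matrix.fromRows B (-B)) (C0 := C0) (Δ := Δ)
    (fun i => by rw [hAd']; exact (hdiag _).1) (fun i => by rw [hAd']; exact (hdiag _).2)
    (fun i j => by
      obtain ⟨s, hs, -, h⟩ := fromRows_neg_mul_transpose_apply i j
      rw [h, h, ← mul_sub, abs_mul, hs, one_mul]
      exact hAB _ _) x
  rw [measureReal_abs_le_eq hξ hA, measureReal_abs_le_eq hζ hB]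
  refine key.trans ?_
  have hn' : (1 : ℝ) ≤ n := by exact_mod_cast hn
  have hl : 0 ≤ Real.log n := Real.log_nonneg hn'
  have hcard : Real.log (Fintype.card (Fin n ⊕ Fin n)) ≤ Real.log n + 1 := by
    rw [Fintype.card_sum, Fintype.card_fin, ← two_mul, Nat.cast_mul,
      Real.log_mul (by norm_num) (by positivity), Nat.cast_ofNat]
    linarith [Real.log_two_lt_d9]
  have hcard0 : 0 ≤ Real.log (Fintype.card (Fin n ⊕ Fin n)) := Real.log_natCast_nonneg _
  set L := Real.log (Fintype.card (Fin n ⊕ Fin n))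
  set l := Real.log n
  have hpoly : (L + 2) * (L + 1 + C0 / 2) ≤ (12 + 2 * C0) * (1 + l ^ 3) := by
    have h1 : (L + 2) * (L + 1 + C0 / 2) ≤ (l + 3) * (l + 2 + C0 / 2) := by
      exact mul_le_mul (by linarith) (by linarith) (by positivity) (by positivity)
    have h2 : l ≤ 1 + l ^ 3 := by nlinarith [mul_nonneg hl (sq_nonneg (l - 1)), sq_nonneg (l - 1)]
    have h3 : l ^ 2 ≤ 1 + l ^ 3 := by nlinarith [mul_nonneg hl (sq_nonneg (l - 1)), sq_nonneg (l - 1)]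
    have h4 : 0 ≤ l ^ 3 := by positivity
    nlinarith [mul_le_mul_of_nonneg_left h2 hC0, mul_nonneg hC0 h4]
  have hsecond : 0 ≤ Δ ^ ((1 : ℝ) / 6) / (1 + l ^ ((1 : ℝ) / 4)) := by positivity
  have hfirst : 4 * K + (L + 2) * (16 * (L + 1 + C0 / 2) / c0) ≤
      (4 * K + 16 * (12 + 2 * C0) / c0) * (1 + l ^ 3) := by
    have e1 : (L + 2) * (16 * (L + 1 + C0 / 2) / c0) =
        16 / c0 * ((L + 2) * (L + 1 + C0 / 2)) := by ring
    have e2 : (4 * K + 16 * (12 + 2 * C0) / c0) * (1 + l ^ 3) =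
        4 * K * (1 + l ^ 3) + 16 / c0 * ((12 + 2 * C0) * (1 + l ^ 3)) := by ring
    rw [e1, e2]
    have h4 : 0 ≤ l ^ 3 := by positivity
    have h5 : 0 ≤ 16 / c0 := by positivity
    exact add_le_add (by nlinarith) (mul_le_mul_of_nonneg_left hpoly h5)
  calc _ ≤ Δ ^ ((1 : ℝ) / 3) * ((4 * K + 16 * (12 + 2 * C0) / c0) * (1 + l ^ 3)) := by gcongr
    _ = (4 * K + 16 * (12 + 2 * C0) / c0) * (Δ ^ ((1 : ℝ) / 3) * (1 + l ^ 3)) := by ring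
    _ ≤ _ := by
      gcongr
      linarith

end ZP
end
end

section
/- Kernel bias bound: let K : ℝ → [0,∞) be continuously differentiable, decreasing on [0,∞), with K(0) = 1, and let α > 1. Then, as k_n → ∞, Σ_{s=0}^∞ (1 − K(s/k_n)) / (1 + s^α) = O(v_n), where v_n = k_n^{1−α} if 1 < α < 2, v_n = log(k_n)/k_n if α = 2, and v_n = 1/k_n if α > 2. In particular Σ_{s=0}^∞ (1 − K(s/k_n))/(1+s^α) ≤ (sup_{x∈[0,1]}|K′(x)|/k_n) Σ_{s=0}^{⌊k_n⌋} s/(1+s^α) + Σ_{s>⌊k_n⌋} 1/(1+s^α). -/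
open Filter Asymptotics

noncomputable section

namespace ZP

theorem sub_one_rpow_le {p x : ℝ} (hp0 : 0 ≤ p) (hp1 : p ≤ 1) (hx : 1 ≤ x) :
    p * x ^ (p - 1) ≤ x ^ p - (x - 1) ^ p := by
  have hx0 : 0 < x := by linarith
  have hinv : x⁻¹ ≤ 1 := inv_le_one_of_one_le₀ hx
  have h := rpow_one_add_le_one_add_mul_self (s := -x⁻¹) (by linarith) hp0 hp1
  have h1 : x - 1 = x * (1 + -x⁻¹) := by field_simp; ring
  rw [h1, Real.mul_rpow hx0.le (by linarith), Real.rpow_sub_one hx0.ne']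
  have h2 := mul_le_mul_of_nonneg_left h (Real.rpow_nonneg hx0.le p)
  have h3 : x ^ p * (1 + p * -x⁻¹) = x ^ p - p * (x ^ p / x) := by ring
  linarith

theorem mul_rpow_neg_le_sub_one_rpow {α x : ℝ} (hα : 1 < α) (hx : 1 < x) :
    (α - 1) * x ^ (-α) ≤ (x - 1) ^ (1 - α) - x ^ (1 - α) := by
  have hx0 : 0 < x := by linarith
  have hpos : 0 < 1 - x⁻¹ := by linarith [inv_lt_one_of_one_lt₀ hx]
  have h : 1 + (α - 1) * x⁻¹ ≤ (1 - x⁻¹) ^ (1 - α) := by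
    rw [Real.rpow_def_of_pos hpos]
    have h1 := Real.log_le_sub_one_of_pos hpos
    have h2 := Real.add_one_le_exp (Real.log (1 - x⁻¹) * (1 - α))
    nlinarith
  have h1 : x - 1 = x * (1 - x⁻¹) := by field_simp
  have h4 : x ^ (-α) = x ^ (1 - α) * x⁻¹ := by
    rw [show -α = (1 - α) - 1 by ring, Real.rpow_sub_one hx0.ne', div_eq_mul_inv]
  rw [h1, Real.mul_rpow hx0.le hpos.le, h4]
  have h2 := mul_le_mul_of_nonneg_left h (Real.rpow_nonneg hx0.le (1 - α))
  nlinarith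

theorem one_div_one_add_rpow_le {α x : ℝ} (hx : 0 < x) :
    1 / (1 + x ^ α) ≤ x ^ (-α) := by
  have := Real.rpow_pos_of_pos hx α
  rw [Real.rpow_neg hx.le, ← one_div]
  exact one_div_le_one_div_of_le this (by linarith)

theorem div_one_add_rpow_le {α x : ℝ} (hx : 0 < x) :
    x / (1 + x ^ α) ≤ x ^ (1 - α) := by
  have h := mul_le_mul_of_nonneg_left (one_div_one_add_rpow_le (α := α) hx) hx.le
  rw [sub_eq_add_neg, Real.rpow_add hx, Real.rpow_one]
  simpa [div_eq_mul_inv] using h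

theorem summable_one_div_one_add_rpow {α : ℝ} (hα : 1 < α) :
    Summable fun s : ℕ => 1 / (1 + (s : ℝ) ^ α) := by
  refine (summable_nat_add_iff 1).1 (Summable.of_nonneg_of_le (fun s => by positivity)
    (fun s => ?_) ((summable_nat_add_iff 1).2 (Real.summable_nat_rpow.2 (by linarith : -α < -1))))
  exact one_div_one_add_rpow_le (by positivity)

theorem sum_range_succ_div_le_of_lt_two {α : ℝ} (hα : 1 < α) (hα2 : α < 2) (m : ℕ) :
    ∑ s ∈ Finset.range (m + 1), (s : ℝ) / (1 + (s : ℝ) ^ α) ≤ (m : ℝ) ^ (2 - α) / (2 - α) := by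
  have h2 : 0 < 2 - α := by linarith
  induction m with
  | zero => simp [Real.zero_rpow h2.ne']
  | succ m ih =>
    rw [Finset.sum_range_succ]
    have hx : (0 : ℝ) < ((m + 1 : ℕ) : ℝ) := by positivity
    have h := sub_one_rpow_le h2.le (by linarith) (x := ((m + 1 : ℕ) : ℝ)) (by simp)
    have h' := div_one_add_rpow_le (α := α) hx
    rw [show 2 - α - 1 = 1 - α by ring, show ((m + 1 : ℕ) : ℝ) - 1 = m by simp] at h
    rw [le_div_iff₀ h2] at ih ⊢
    nlinarith

theorem sum_range_succ_div_le_two (m : ℕ) :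
    ∑ s ∈ Finset.range (m + 1), (s : ℝ) / (1 + (s : ℝ) ^ (2 : ℝ)) ≤ 1 + Real.log m := by
  refine le_trans ?_ (harmonic_le_one_add_log m)
  rw [Finset.sum_range_succ', harmonic]
  push_cast
  simp only [zero_div, add_zero]
  refine Finset.sum_le_sum fun s _ => ?_
  have h := div_one_add_rpow_le (α := 2) (x := (s : ℝ) + 1) (by positivity)
  rwa [show (1 : ℝ) - 2 = -1 by norm_num, Real.rpow_neg_one] at h

theorem sum_range_div_le_of_two_lt {α : ℝ} (hα2 : 2 < α) (m : ℕ) :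
    ∑ s ∈ Finset.range m, (s : ℝ) / (1 + (s : ℝ) ^ α) ≤ ∑' s : ℕ, (s : ℝ) ^ (1 - α) := by
  refine le_trans (Finset.sum_le_sum fun s _ => ?_)
    ((Real.summable_nat_rpow.2 (by linarith : 1 - α < -1)).sum_le_tsum _
      fun s _ => by positivity)
  rcases s.eq_zero_or_pos with rfl | hs
  · simp [Real.zero_rpow (by linarith : 1 - α ≠ 0)]
  · exact div_one_add_rpow_le (by positivity)

theorem tsum_tail_le {α : ℝ} (hα : 1 < α) {m : ℕ} (hm : 0 < m) :
    ∑' s : ℕ, (if m < s then 1 / (1 + (s : ℝ) ^ α) else 0) ≤ (m : ℝ) ^ (1 - α) / (α - 1) := by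
  have hα0 : 0 < α - 1 := by linarith
  have hnn : ∀ s : ℕ, 0 ≤ if m < s then 1 / (1 + (s : ℝ) ^ α) else 0 := fun s => by
    split_ifs <;> positivity
  have key : ∀ j : ℕ, ∑ s ∈ Finset.range (m + 1 + j),
      (if m < s then 1 / (1 + (s : ℝ) ^ α) else 0) ≤
        ((m : ℝ) ^ (1 - α) - ((m + j : ℕ) : ℝ) ^ (1 - α)) / (α - 1) := by
    intro j
    induction j with
    | zero =>
      rw [Finset.sum_eq_zero fun s hs => if_neg (by simp at hs; omega)]
      simp
    | succ j ih =>
      rw [← add_assoc (m + 1) j 1, Finset.sum_range_succ, if_pos (by omega)]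
      have hx : (1 : ℝ) < ((m + 1 + j : ℕ) : ℝ) := by exact_mod_cast (by omega : 1 < m + 1 + j)
      have h := mul_rpow_neg_le_sub_one_rpow hα hx
      have h' := one_div_one_add_rpow_le (α := α) (by linarith : (0 : ℝ) < ((m + 1 + j : ℕ) : ℝ))
      rw [show ((m + 1 + j : ℕ) : ℝ) - 1 = ((m + j : ℕ) : ℝ) by push_cast; ring] at h
      rw [show m + (j + 1) = m + 1 + j by ring]
      rw [le_div_iff₀ hα0] at ih ⊢
      nlinarith
  refine Real.tsum_le_of_sum_range_le hnn fun n => ?_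
  refine (Finset.sum_le_sum_of_subset_of_nonneg (t := Finset.range (m + 1 + n))
    (Finset.range_mono (by omega)) fun s _ _ => hnn s).trans ((key n).trans ?_)
  gcongr
  have : (0 : ℝ) ≤ ((m + n : ℕ) : ℝ) ^ (1 - α) := by positivity
  linarith

theorem one_sub_le_sSup_abs_deriv_mul {K : ℝ → ℝ} (hK : ContDiff ℝ 1 K) (hK0 : K 0 = 1)
    {x : ℝ} (hx : x ∈ Set.Icc (0 : ℝ) 1) :
    1 - K x ≤ sSup ((fun x => |deriv K x|) '' Set.Icc (0 : ℝ) 1) * x := by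
  have hb : BddAbove ((fun x => |deriv K x|) '' Set.Icc (0 : ℝ) 1) :=
    (isCompact_Icc.image (hK.continuous_deriv le_rfl).abs).bddAbove
  have h := (convex_Icc (0 : ℝ) 1).norm_image_sub_le_of_norm_deriv_le (f := K)
    (fun y _ => (hK.differentiable one_ne_zero) y)
    (fun y hy => le_csSup hb (Set.mem_image_of_mem _ hy))
    (Set.left_mem_Icc.2 zero_le_one) hx
  rw [hK0, sub_zero, Real.norm_eq_abs, Real.norm_of_nonneg hx.1] at h
  linarith [neg_abs_le (K x - 1)]

theorem tsum_one_sub_le {K : ℝ → ℝ} {α k : ℝ} (hKnn : ∀ x, 0 ≤ K x) (hK : ContDiff ℝ 1 K)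
    (hK0 : K 0 = 1) (hKd : AntitoneOn K (Set.Ici 0)) (hα : 1 < α) (hk : 0 < k) :
    ∑' s : ℕ, (1 - K ((s : ℝ) / k)) / (1 + (s : ℝ) ^ α) ≤
      (sSup ((fun x => |deriv K x|) '' Set.Icc (0 : ℝ) 1) / k) *
          ∑ s ∈ Finset.range (⌊k⌋₊ + 1), (s : ℝ) / (1 + (s : ℝ) ^ α)
        + ∑' s : ℕ, if ⌊k⌋₊ < s then 1 / (1 + (s : ℝ) ^ α) else 0 := by
  set M := sSup ((fun x => |deriv K x|) '' Set.Icc (0 : ℝ) 1)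
  have hsum := summable_one_div_one_add_rpow hα
  have hle : ∀ s : ℕ, (1 - K ((s : ℝ) / k)) / (1 + (s : ℝ) ^ α) ≤ 1 / (1 + (s : ℝ) ^ α) :=
    fun s => by
      gcongr
      linarith [hKnn ((s : ℝ) / k)]
  have hnn : ∀ s : ℕ, 0 ≤ (1 - K ((s : ℝ) / k)) / (1 + (s : ℝ) ^ α) := fun s => by
    have hs : (0 : ℝ) ≤ (s : ℝ) / k := by positivity
    have := hKd Set.self_mem_Ici (Set.mem_Ici.2 hs) hs
    exact div_nonneg (by linarith) (by positivity)
  have htail : Summable fun s : ℕ => if ⌊k⌋₊ < s then 1 / (1 + (s : ℝ) ^ α) else 0 :=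
    Summable.of_nonneg_of_le (fun s => by split_ifs <;> positivity)
      (fun s => by split_ifs <;> first | exact le_rfl | positivity) hsum
  have hhead : HasSum
      (fun s : ℕ => if s ∈ Finset.range (⌊k⌋₊ + 1) then
        M / k * ((s : ℝ) / (1 + (s : ℝ) ^ α)) else 0)
      (∑ s ∈ Finset.range (⌊k⌋₊ + 1), M / k * ((s : ℝ) / (1 + (s : ℝ) ^ α))) := by
    rw [← Finset.sum_congr rfl fun s hs => if_pos hs]
    exact hasSum_sum_of_ne_finset_zero fun s hs => if_neg hs
  rw [Finset.mul_sum, ← hhead.tsum_eq, ← hhead.summable.tsum_add htail]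
  refine (Summable.of_nonneg_of_le hnn hle hsum).tsum_le_tsum (fun s => ?_)
    (hhead.summable.add htail)
  by_cases hs : ⌊k⌋₊ < s
  · rw [if_pos hs, if_neg (by simp; omega), zero_add]
    exact hle s
  · rw [if_neg hs, if_pos (by simp; omega), add_zero]
    have hsk : (s : ℝ) ≤ k := (Nat.le_floor_iff hk.le).1 (not_lt.1 hs)
    have h := one_sub_le_sSup_abs_deriv_mul hK hK0
      (x := (s : ℝ) / k) ⟨by positivity, (div_le_one hk).2 hsk⟩
    calc (1 - K ((s : ℝ) / k)) / (1 + (s : ℝ) ^ α)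
        ≤ (M * ((s : ℝ) / k)) / (1 + (s : ℝ) ^ α) := by gcongr
      _ = M / k * ((s : ℝ) / (1 + (s : ℝ) ^ α)) := by ring

/-- The rate attained by the kernel bias at bandwidth `k`. -/
def biasRate (α k : ℝ) : ℝ :=
  if α < 2 then k ^ (1 - α) else if α = 2 then Real.log k / k else k⁻¹

theorem exists_sum_head_div_le {α : ℝ} (hα : 1 < α) :
    ∃ C, 0 ≤ C ∧ ∀ k : ℝ, Real.exp 1 ≤ k →
      (∑ s ∈ Finset.range (⌊k⌋₊ + 1), (s : ℝ) / (1 + (s : ℝ) ^ α)) / k ≤ C * biasRate α k := by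
  have he : (1 : ℝ) < Real.exp 1 := Real.one_lt_exp_iff.2 one_pos
  rcases lt_trichotomy α 2 with h | rfl | h
  · refine ⟨(2 - α)⁻¹, inv_nonneg.2 (by linarith), fun k hk => ?_⟩
    have hk0 : 0 < k := by linarith
    have h2 : 0 < 2 - α := by linarith
    rw [biasRate, if_pos h, div_le_iff₀ hk0]
    refine (sum_range_succ_div_le_of_lt_two hα h _).trans ?_
    have h3 : (⌊k⌋₊ : ℝ) ^ (2 - α) ≤ k ^ (2 - α) :=
      Real.rpow_le_rpow (by positivity) (Nat.floor_le hk0.le) h2.le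
    have h4 : k ^ (2 - α) = k ^ (1 - α) * k := by
      rw [← Real.rpow_add_one hk0.ne']; ring_nf
    rw [mul_assoc, ← h4, div_eq_inv_mul]
    gcongr
  · refine ⟨2, zero_le_two, fun k hk => ?_⟩
    have hk0 : 0 < k := by linarith
    rw [biasRate, if_neg (lt_irrefl _), if_pos rfl, ← mul_div_assoc]
    gcongr
    refine (sum_range_succ_div_le_two _).trans ?_
    have h1 : 1 ≤ Real.log k := (Real.le_log_iff_exp_le hk0).2 hk
    have h2 : Real.log ⌊k⌋₊ ≤ Real.log k :=
      Real.log_le_log (by exact_mod_cast Nat.floor_pos.2 (by linarith)) (Nat.floor_le hk0.le)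
    linarith
  · refine ⟨∑' s : ℕ, (s : ℝ) ^ (1 - α), tsum_nonneg fun s => by positivity, fun k hk => ?_⟩
    have hk0 : 0 < k := by linarith
    rw [biasRate, if_neg h.not_gt, if_neg h.ne', ← div_eq_mul_inv]
    gcongr
    exact sum_range_div_le_of_two_lt h _

theorem rpow_one_sub_le_biasRate {α k : ℝ} (hk : Real.exp 1 ≤ k) :
    k ^ (1 - α) ≤ biasRate α k := by
  have he : (1 : ℝ) < Real.exp 1 := Real.one_lt_exp_iff.2 one_pos
  have hk0 : 0 < k := by linarith
  rcases lt_trichotomy α 2 with h | rfl | h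
  · rw [biasRate, if_pos h]
  · rw [biasRate, if_neg (lt_irrefl _), if_pos rfl, show (1 : ℝ) - 2 = -1 by norm_num,
      Real.rpow_neg_one, ← one_div]
    gcongr
    exact (Real.le_log_iff_exp_le hk0).2 hk
  · rw [biasRate, if_neg h.not_gt, if_neg h.ne', ← Real.rpow_neg_one]
    exact Real.rpow_le_rpow_of_exponent_le (by linarith) (by linarith)

theorem tsum_tail_floor_le {α k : ℝ} (hα : 1 < α) (hk : 1 ≤ k) :
    ∑' s : ℕ, (if ⌊k⌋₊ < s then 1 / (1 + (s : ℝ) ^ α) else 0) ≤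
      (2⁻¹ ^ (1 - α) / (α - 1)) * k ^ (1 - α) := by
  have hm : 0 < ⌊k⌋₊ := Nat.floor_pos.2 hk
  have hα0 : 0 < α - 1 := by linarith
  refine (tsum_tail_le hα hm).trans ?_
  have hm1 : (1 : ℝ) ≤ ⌊k⌋₊ := by exact_mod_cast hm
  have h : 2⁻¹ * k ≤ ⌊k⌋₊ := by linarith [Nat.lt_floor_add_one k]
  have h' : (⌊k⌋₊ : ℝ) ^ (1 - α) ≤ (2⁻¹ * k) ^ (1 - α) :=
    Real.rpow_le_rpow_of_nonpos (by positivity) h (by linarith)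
  rw [Real.mul_rpow (by norm_num) (by linarith)] at h'
  rw [div_mul_eq_mul_div]
  gcongr

/-- **Kernel bias bound** (display (34) in appendix C of Zhang–Politis): for a continuously
differentiable kernel `K` decreasing on `[0,∞)` with `K(0) = 1` and `α > 1`, as `k_n → ∞`,
`Σ_{s=0}^∞ (1 − K(s/k_n))/(1 + s^α) = O(v_n)` with `v_n` as in the statement; and the sum is
bounded by the displayed split into the ranges `s ≤ ⌊k_n⌋` and `s > ⌊k_n⌋`. -/
theorem kernel_bias_bound
    (K : ℝ → ℝ) (α : ℝ) (kb : ℕ → ℝ)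
    (h_K_nonneg : ∀ x, 0 ≤ K x)
    (h_K_smooth : ContDiff ℝ 1 K) (h_K0 : K 0 = 1)
    (h_K_dec : AntitoneOn K (Set.Ici 0))
    (h_α : 1 < α)
    (h_kb_pos : ∀ n, 0 < kb n)
    (h_kb_top : Tendsto kb atTop atTop) :
    -- O(v_n) bound
    ((fun n => ∑' s : ℕ, (1 - K ((s : ℝ) / kb n)) / (1 + (s : ℝ) ^ α))
        =O[atTop] fun n =>
          if α < 2 then kb n ^ (1 - α)
          else if α = 2 then Real.log (kb n) / kb n
          else (kb n)⁻¹) ∧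
    -- the explicit split
    (∀ n : ℕ,
      ∑' s : ℕ, (1 - K ((s : ℝ) / kb n)) / (1 + (s : ℝ) ^ α) ≤
        (sSup ((fun x => |deriv K x|) '' Set.Icc (0 : ℝ) 1) / kb n) *
            ∑ s ∈ Finset.range (⌊kb n⌋₊ + 1), (s : ℝ) / (1 + (s : ℝ) ^ α)
          + ∑' s : ℕ, if ⌊kb n⌋₊ < s then 1 / (1 + (s : ℝ) ^ α) else 0) := by
  refine ⟨?_, fun n => tsum_one_sub_le h_K_nonneg h_K_smooth h_K0 h_K_dec h_α (h_kb_pos n)⟩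
  obtain ⟨C, hC0, hC⟩ := exists_sum_head_div_le h_α
  set M := sSup ((fun x => |deriv K x|) '' Set.Icc (0 : ℝ) 1) with hM
  have hM0 : 0 ≤ M := Real.sSup_nonneg (by rintro _ ⟨x, -, rfl⟩; exact abs_nonneg _)
  have hα0 : 0 < α - 1 := by linarith
  refine IsBigO.of_bound (M * C + 2⁻¹ ^ (1 - α) / (α - 1)) ?_
  filter_upwards [h_kb_top.eventually_ge_atTop (Real.exp 1)] with n hn
  have he : (1 : ℝ) < Real.exp 1 := Real.one_lt_exp_iff.2 one_pos
  have hrate := rpow_one_sub_le_biasRate (α := α) hn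
  have hsplit := tsum_one_sub_le h_K_nonneg h_K_smooth h_K0 h_K_dec h_α (h_kb_pos n)
  have htail := tsum_tail_floor_le h_α (by linarith : 1 ≤ kb n)
  have hhead := mul_le_mul_of_nonneg_left (hC _ hn) hM0
  have hrate' := mul_le_mul_of_nonneg_left hrate
    (by positivity : (0 : ℝ) ≤ 2⁻¹ ^ (1 - α) / (α - 1))
  rw [Real.norm_of_nonneg (tsum_nonneg fun s => ?_)]
  · refine le_trans ?_ (mul_le_mul_of_nonneg_left (Real.le_norm_self (biasRate α (kb n))) ?_)
    · rw [← hM, div_mul_eq_mul_div, mul_div_assoc] at hsplit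
      linarith
    · positivity
  · have hs : (0 : ℝ) ≤ (s : ℝ) / kb n := div_nonneg s.cast_nonneg (h_kb_pos n).le
    have := h_K_dec Set.self_mem_Ici (Set.mem_Ici.2 hs) hs
    exact div_nonneg (by linarith) (by positivity)

end ZP
end
end
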